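/- Let 1 < p < ∞. There exists an R-Ritt operator T : L^p([0,1]) → L^p([0,1]) (with Lebesgue measure) which is not p-polynomially bounded: for every constant C ≥ 1 there is a complex polynomial φ with ‖φ(T)‖ > C ‖φ(S)‖_{B(ℓ^p(ℤ))}. -/

import Mathlib

open MeasureTheory Polynomial unitInterval
open scoped ENNReal

/-- The map `k ↦ k - 1` preserves the counting measure on `ℤ`. -/
theorem shift_measurePreserving :
    MeasurePreserving (fun k : ℤ => k - 1) Measure.count Measure.count := by
  constructor
  · exact Measurable.of_discrete
  · ext s hs
    rw [Measure.map_apply Measurable.of_discrete hs]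
    have h : (fun k : ℤ => k - 1) ⁻¹' s = (fun k : ℤ => k + 1) '' s := by
      ext k
      constructor
      · intro hk; exact ⟨k - 1, hk, by ring⟩
      · rintro ⟨a, ha, rfl⟩; simpa using ha
    rw [h, Measure.count_injective_image (fun a b hab => by simpa using hab)]

/-- The shift operator `S` on `ℓ^p(ℤ)`, realized as `L^p` of the counting measure on `ℤ`:
`(S t) k = t (k - 1)`. -/
noncomputable def shiftOp (P : ℝ≥0∞) [Fact (1 ≤ P)] :
    Lp ℂ P (Measure.count : Measure ℤ) →L[ℂ] Lp ℂ P (Measure.count : Measure ℤ) :=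
  (Lp.compMeasurePreservingₗᵢ ℂ (fun k : ℤ => k - 1) shift_measurePreserving).toContinuousLinearMap

/-- A set `F` of bounded operators on `L^p(Ω)` is R-bounded. -/
def RBoundedSet {Ω : Type*} [MeasurableSpace Ω] {μ : Measure Ω}
    (p : ℝ) [Fact (1 ≤ ENNReal.ofReal p)]
    (F : Set (Lp ℂ (ENNReal.ofReal p) μ →L[ℂ] Lp ℂ (ENNReal.ofReal p) μ)) : Prop :=
  ∃ C : ℝ, 0 ≤ C ∧
    ∀ (m : ℕ) (S : Fin m → (Lp ℂ (ENNReal.ofReal p) μ →L[ℂ] Lp ℂ (ENNReal.ofReal p) μ)),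
      (∀ k, S k ∈ F) → ∀ x : Fin m → Lp ℂ (ENNReal.ofReal p) μ,
        eLpNorm (fun ω => (∑ k, ‖(S k) (x k) ω‖ ^ 2) ^ (1 / 2 : ℝ)) (ENNReal.ofReal p) μ ≤
          ENNReal.ofReal C *
            eLpNorm (fun ω => (∑ k, ‖(x k) ω‖ ^ 2) ^ (1 / 2 : ℝ)) (ENNReal.ofReal p) μ

/-- `T` is an R-Ritt operator: `{T^n : n ≥ 0} ∪ {n(T^n - T^{n-1}) : n ≥ 1}` is R-bounded. -/
def RRitt {Ω : Type*} [MeasurableSpace Ω] {μ : Measure Ω}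
    (p : ℝ) [Fact (1 ≤ ENNReal.ofReal p)]
    (T : Lp ℂ (ENNReal.ofReal p) μ →L[ℂ] Lp ℂ (ENNReal.ofReal p) μ) : Prop :=
  RBoundedSet p ({A | ∃ n : ℕ, A = T ^ n} ∪
    {A | ∃ n : ℕ, 1 ≤ n ∧ A = (n : ℂ) • (T ^ n - T ^ (n - 1))})

set_option linter.unusedSectionVars false

namespace RR

/-- increments of a concave power decrease -/
lemma rpow_incr_anti {q : ℝ} (hq0 : 0 ≤ q) (hq1 : q ≤ 1) {s S w : ℝ} (hs : 0 ≤ s) (hsS : s ≤ S)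
    (hw : 0 ≤ w) : (S + w) ^ q - S ^ q ≤ (s + w) ^ q - s ^ q := by
  rcases eq_or_lt_of_le (show s ≤ S + w by linarith) with h | h
  · have h1 : s = S := by linarith
    subst h1; exact le_refl _
  have hc := Real.concaveOn_rpow hq0 hq1
  have hd : 0 < S + w - s := by linarith
  set a := w / (S + w - s) with ha
  set b := (S - s) / (S + w - s) with hb
  have ha0 : 0 ≤ a := div_nonneg hw hd.le
  have hb0 : 0 ≤ b := div_nonneg (by linarith) hd.le
  have hab : a + b = 1 := by rw [ha, hb]; field_simp; ring
  have hba : b + a = 1 := by linarith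
  have e1 := hc.2 (show s ∈ Set.Ici (0:ℝ) from hs) (show S + w ∈ Set.Ici (0:ℝ) from by
    simp; linarith) ha0 hb0 hab
  have e2 := hc.2 (show s ∈ Set.Ici (0:ℝ) from hs) (show S + w ∈ Set.Ici (0:ℝ) from by
    simp; linarith) hb0 ha0 hba
  simp only [smul_eq_mul] at e1 e2
  have f1 : a * s + b * (S + w) = S := by rw [ha, hb]; field_simp; ring
  have f2 : b * s + a * (S + w) = s + w := by rw [ha, hb]; field_simp; ring
  rw [f1] at e1
  rw [f2] at e2
  have : (a + b) * s ^ q + (a + b) * (S + w) ^ q ≤ S ^ q + (s + w) ^ q := by linarith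
  rw [hab] at this
  linarith

lemma rpow_incr_scale {q : ℝ} (hq0 : 0 ≤ q) (hq1 : q ≤ 1) {s u κ C : ℝ} (hs : 0 ≤ s)
    (hu : 0 ≤ u) (hκ : 0 < κ) (hC : κ ≤ C) :
    (s + C * u) ^ q - s ^ q ≤ C / κ * ((s + κ * u) ^ q - s ^ q) := by
  have hc := Real.concaveOn_rpow hq0 hq1
  have hC0 : 0 < C := lt_of_lt_of_le hκ hC
  have ha0 : 0 ≤ κ / C := by positivity
  have hb0 : 0 ≤ 1 - κ / C := by
    rw [sub_nonneg, div_le_one hC0]; exact hC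
  have e1 := hc.2 (show s + C * u ∈ Set.Ici (0:ℝ) from by simp; positivity)
    (show s ∈ Set.Ici (0:ℝ) from hs) ha0 hb0 (by ring)
  simp only [smul_eq_mul] at e1
  have f1 : κ / C * (s + C * u) + (1 - κ / C) * s = s + κ * u := by field_simp; ring
  rw [f1] at e1
  have e2 : κ / C * ((s + C * u) ^ q - s ^ q) ≤ (s + κ * u) ^ q - s ^ q := by linarith
  calc (s + C * u) ^ q - s ^ q = C / κ * (κ / C * ((s + C * u) ^ q - s ^ q)) := by
        field_simp
    _ ≤ _ := by gcongr

lemma rpow_mid {q : ℝ} (hq0 : 0 ≤ q) (hq1 : q ≤ 1) {u v : ℝ} (hu : 0 ≤ u) (hv : 0 ≤ v) :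
    (u ^ q + v ^ q) / 2 ≤ ((u + v) / 2) ^ q := by
  have hc := Real.concaveOn_rpow hq0 hq1
  have e1 := hc.2 (show u ∈ Set.Ici (0:ℝ) from hu) (show v ∈ Set.Ici (0:ℝ) from hv)
    (show (0:ℝ) ≤ 1/2 by norm_num) (show (0:ℝ) ≤ 1/2 by norm_num) (by norm_num)
  simp only [smul_eq_mul] at e1
  have : 1 / 2 * u + 1 / 2 * v = (u + v) / 2 := by ring
  rw [this] at e1
  linarith

/-- symmetric means of concave powers decrease with the spread -/
lemma rpow_spread {q : ℝ} (hq0 : 0 ≤ q) (hq1 : q ≤ 1) {A D E : ℝ} (hD : |D| ≤ E) (hE : E ≤ A) :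
    (A + E) ^ q + (A - E) ^ q ≤ (A + D) ^ q + (A - D) ^ q := by
  have h := abs_le.1 hD
  have hE0 : 0 ≤ E := le_trans (abs_nonneg _) hD
  have := rpow_incr_anti hq0 hq1 (s := A - E) (S := A + D) (w := E - D) (by linarith)
    (by linarith) (by linarith)
  have e1 : A + D + (E - D) = A + E := by ring
  have e2 : A - E + (E - D) = A - D := by ring
  rw [e1, e2] at this
  linarith

lemma one_two_point {p : ℝ} (hp : 1 < p) (hp2 : p ≤ 2) {t : ℝ} (ht0 : 0 ≤ t) (ht1 : t ≤ 1) :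
    2 + p * (p - 1) / 2 * t ^ 2 ≤ (1 + t) ^ p + (1 - t) ^ p := by
  set m : ℝ := p * (p - 1) / 4 with hm
  have hconv : ConvexOn ℝ (Set.Icc (0:ℝ) 2) (fun s : ℝ => s ^ p - m * s ^ 2) := by
    refine convexOn_of_hasDerivWithinAt2_nonneg (convex_Icc 0 2)
      (f' := fun s => p * s ^ (p - 1) - m * (2 * s))
      (f'' := fun s => p * ((p - 1) * s ^ (p - 1 - 1)) - m * 2) ?_ ?_ ?_ ?_
    · apply ContinuousOn.sub
      · exact (Real.continuous_rpow_const (by linarith)).continuousOn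
      · fun_prop
    · intro x hx
      rw [interior_Icc] at hx
      apply HasDerivAt.hasDerivWithinAt
      have h1 := Real.hasDerivAt_rpow_const (x := x) (p := p) (Or.inl hx.1.ne')
      have h2 := (hasDerivAt_pow 2 x).const_mul m
      refine (h1.sub h2).congr_deriv ?_
      norm_num
    · intro x hx
      rw [interior_Icc] at hx
      apply HasDerivAt.hasDerivWithinAt
      have h1 := (Real.hasDerivAt_rpow_const (x := x) (p := p - 1) (Or.inl hx.1.ne')).const_mul p
      have h2 := ((hasDerivAt_id x).const_mul 2).const_mul m
      refine (h1.sub h2).congr_deriv ?_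
      norm_num
    · intro x hx
      rw [interior_Icc] at hx
      have h1 : (1/2 : ℝ) ≤ x ^ (p - 1 - 1) := by
        calc (1/2 : ℝ) = 2 ^ (-1 : ℝ) := by rw [Real.rpow_neg_one]; norm_num
          _ ≤ 2 ^ (p - 1 - 1) := Real.rpow_le_rpow_of_exponent_le (by norm_num) (by linarith)
          _ ≤ x ^ (p - 1 - 1) :=
            Real.rpow_le_rpow_of_nonpos hx.1 hx.2.le (by linarith)
      have h2 : 0 < p * (p - 1) := by nlinarith
      simp only [hm]
      nlinarith
  have := hconv.2 (show (1 + t) ∈ Set.Icc (0:ℝ) 2 by constructor <;> linarith)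
    (show (1 - t) ∈ Set.Icc (0:ℝ) 2 by constructor <;> linarith)
    (show (0:ℝ) ≤ 1/2 by norm_num) (show (0:ℝ) ≤ 1/2 by norm_num) (by norm_num)
  simp only [smul_eq_mul] at this
  have e : 1 / 2 * (1 + t) + 1 / 2 * (1 - t) = 1 := by ring
  rw [e, Real.one_rpow] at this
  nlinarith

lemma real_two_point {p : ℝ} (hp : 1 < p) (hp2 : p ≤ 2) {x h : ℝ} (hx : 0 ≤ x) (hh : 0 ≤ h)
    (hle : h ≤ x) :
    (x ^ 2 + (p - 1) / 2 * h ^ 2) ^ (p / 2) ≤ ((x + h) ^ p + (x - h) ^ p) / 2 := by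
  rcases hx.eq_or_lt with h0 | hx0
  · subst h0
    have : h = 0 := le_antisymm hle hh
    subst this
    simp [Real.zero_rpow (show p ≠ 0 by linarith), Real.zero_rpow (show p / 2 ≠ 0 by linarith)]
  set t := h / x with ht
  have hhx : h = x * t := by rw [ht]; field_simp
  have ht0 : 0 ≤ t := by positivity
  have ht1 : t ≤ 1 := by rw [ht, div_le_one hx0]; exact hle
  have key := one_two_point hp hp2 ht0 ht1
  have bern : (1 + (p - 1) / 2 * t ^ 2) ^ (p / 2) ≤ 1 + p / 2 * ((p - 1) / 2 * t ^ 2) := by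
    apply rpow_one_add_le_one_add_mul_self
    · nlinarith [sq_nonneg t]
    · linarith
    · linarith
  have e1 : x ^ 2 + (p - 1) / 2 * h ^ 2 = x ^ 2 * (1 + (p - 1) / 2 * t ^ 2) := by
    rw [hhx]; ring
  have e2 : x + h = x * (1 + t) := by rw [hhx]; ring
  have e3 : x - h = x * (1 - t) := by rw [hhx]; ring
  have e4 : (x ^ 2) ^ (p / 2) = x ^ p := by
    rw [← Real.rpow_natCast, ← Real.rpow_mul hx]; congr 1; push_cast; ring
  rw [e1, e2, e3, Real.mul_rpow (by positivity) (by nlinarith [sq_nonneg t]),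
    Real.mul_rpow hx (by linarith), Real.mul_rpow hx (by linarith), e4, ← mul_add, mul_div_assoc]
  apply mul_le_mul_of_nonneg_left _ (by positivity)
  have : p / 2 * ((p - 1) / 2 * t ^ 2) = p * (p - 1) / 2 * t ^ 2 / 2 := by ring
  linarith

lemma sq_rpow_half {p x : ℝ} (hx : 0 ≤ x) : (x ^ 2) ^ (p / 2) = x ^ p := by
  rw [← Real.rpow_natCast, ← Real.rpow_mul hx]; congr 1; push_cast; ring

lemma norm_add_sq_c (x h : ℂ) :
    ‖x + h‖ ^ 2 = ‖x‖ ^ 2 + ‖h‖ ^ 2 + 2 * (inner ℝ x h : ℝ) := by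
  rw [norm_add_sq_real]; ring

lemma norm_sub_sq_c (x h : ℂ) :
    ‖x - h‖ ^ 2 = ‖x‖ ^ 2 + ‖h‖ ^ 2 - 2 * (inner ℝ x h : ℝ) := by
  rw [norm_sub_sq_real]; ring

/-- two-point uniform convexity -/
lemma tp_lower {p : ℝ} (hp : 1 < p) (hp2 : p ≤ 2) (x h : ℂ) :
    (‖x‖ ^ 2 + (p - 1) / 2 * ‖h‖ ^ 2) ^ (p / 2) ≤ (‖x + h‖ ^ p + ‖x - h‖ ^ p) / 2 := by
  have hq0 : 0 ≤ p / 2 := by linarith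
  have hq1 : p / 2 ≤ 1 := by linarith
  have hin : |2 * (inner ℝ x h : ℝ)| ≤ 2 * ‖x‖ * ‖h‖ := by
    rw [abs_mul, abs_two]
    have := abs_real_inner_le_norm x h
    nlinarith
  have hsp := rpow_spread hq0 hq1 (A := ‖x‖ ^ 2 + ‖h‖ ^ 2) hin (by nlinarith [sq_nonneg (‖x‖ - ‖h‖)])
  rw [← norm_add_sq_c, ← norm_sub_sq_c, sq_rpow_half (norm_nonneg _),
    sq_rpow_half (norm_nonneg _)] at hsp
  have e1 : ‖x‖ ^ 2 + ‖h‖ ^ 2 + 2 * ‖x‖ * ‖h‖ = (‖x‖ + ‖h‖) ^ 2 := by ring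
  rw [e1, sq_rpow_half (by positivity)] at hsp
  rcases le_total ‖h‖ ‖x‖ with hle | hle
  · have e2 : ‖x‖ ^ 2 + ‖h‖ ^ 2 - 2 * ‖x‖ * ‖h‖ = (‖x‖ - ‖h‖) ^ 2 := by ring
    rw [e2, sq_rpow_half (by linarith)] at hsp
    have := real_two_point hp hp2 (norm_nonneg x) (norm_nonneg h) hle
    linarith
  · have e2 : ‖x‖ ^ 2 + ‖h‖ ^ 2 - 2 * ‖x‖ * ‖h‖ = (‖h‖ - ‖x‖) ^ 2 := by ring
    rw [e2, sq_rpow_half (by linarith), add_comm ‖x‖ ‖h‖] at hsp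
    have := real_two_point hp hp2 (norm_nonneg h) (norm_nonneg x) hle
    have h3 : (‖x‖ ^ 2 + (p - 1) / 2 * ‖h‖ ^ 2) ^ (p / 2) ≤
        (‖h‖ ^ 2 + (p - 1) / 2 * ‖x‖ ^ 2) ^ (p / 2) := by
      apply Real.rpow_le_rpow (by have := sq_nonneg ‖h‖; nlinarith [sq_nonneg ‖x‖]) _ hq0
      have : ‖x‖ ^ 2 ≤ ‖h‖ ^ 2 := by gcongr
      nlinarith
    linarith

/-- the Bellman step -/
lemma bellman_step {p : ℝ} (hp : 1 < p) (hp2 : p ≤ 2) {x y h k : ℂ} {C d : ℝ} (hC : 0 ≤ C)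
    (hd : 0 ≤ d) (hk : ‖k‖ ^ 2 ≤ C * ‖h‖ ^ 2 + d * ‖x‖ ^ 2) :
    ((‖x + h‖ ^ 2 + ‖y + k‖ ^ 2) ^ (p / 2) + (‖x - h‖ ^ 2 + ‖y - k‖ ^ 2) ^ (p / 2)) / 2 ≤
      (1 + d) * (‖x‖ ^ 2 + ‖y‖ ^ 2) ^ (p / 2) +
      (C + 1) / ((p - 1) / 2) * ((‖x + h‖ ^ p + ‖x - h‖ ^ p) / 2 - ‖x‖ ^ p) := by
  have hq0 : 0 ≤ p / 2 := by linarith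
  have hq1 : p / 2 ≤ 1 := by linarith
  have h1 := rpow_mid hq0 hq1 (u := ‖x + h‖ ^ 2 + ‖y + k‖ ^ 2) (v := ‖x - h‖ ^ 2 + ‖y - k‖ ^ 2)
    (by positivity) (by positivity)
  have e1 : (‖x + h‖ ^ 2 + ‖y + k‖ ^ 2 + (‖x - h‖ ^ 2 + ‖y - k‖ ^ 2)) / 2 =
      ‖x‖ ^ 2 + ‖y‖ ^ 2 + ‖h‖ ^ 2 + ‖k‖ ^ 2 := by
    rw [norm_add_sq_c, norm_add_sq_c, norm_sub_sq_c, norm_sub_sq_c]; ring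
  rw [e1] at h1
  set S := (1 + d) * (‖x‖ ^ 2 + ‖y‖ ^ 2) with hS
  have h2 : (‖x‖ ^ 2 + ‖y‖ ^ 2 + ‖h‖ ^ 2 + ‖k‖ ^ 2) ^ (p / 2) ≤
      (S + (C + 1) * ‖h‖ ^ 2) ^ (p / 2) := by
    apply Real.rpow_le_rpow (by positivity) _ hq0
    rw [hS]
    nlinarith [mul_nonneg hd (sq_nonneg ‖y‖)]
  have hxS : ‖x‖ ^ 2 ≤ S := by
    rw [hS]
    nlinarith [mul_nonneg hd (sq_nonneg ‖y‖), mul_nonneg hd (sq_nonneg ‖x‖), sq_nonneg ‖y‖]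
  have h3 := rpow_incr_anti hq0 hq1 (s := ‖x‖ ^ 2) (S := S) (w := (C + 1) * ‖h‖ ^ 2)
    (by positivity) hxS (by positivity)
  have h4 := rpow_incr_scale hq0 hq1 (s := ‖x‖ ^ 2) (u := ‖h‖ ^ 2) (κ := (p - 1) / 2)
    (C := C + 1) (by positivity) (by positivity) (by linarith) (by linarith)
  have h5 := tp_lower hp hp2 x h
  have h6 : S ^ (p / 2) ≤ (1 + d) * (‖x‖ ^ 2 + ‖y‖ ^ 2) ^ (p / 2) := by
    rw [hS, Real.mul_rpow (by linarith) (by positivity)]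
    apply mul_le_mul_of_nonneg_right _ (by positivity)
    calc (1 + d) ^ (p / 2) ≤ (1 + d) ^ (1:ℝ) :=
          Real.rpow_le_rpow_of_exponent_le (by linarith) hq1
      _ = 1 + d := Real.rpow_one _
  rw [sq_rpow_half (norm_nonneg x)] at h3 h4
  have h7 : (C + 1) / ((p - 1) / 2) * ((‖x‖ ^ 2 + (p - 1) / 2 * ‖h‖ ^ 2) ^ (p / 2) - ‖x‖ ^ p) ≤
     (C + 1) / ((p - 1) / 2) * ((‖x + h‖ ^ p + ‖x - h‖ ^ p) / 2 - ‖x‖ ^ p) := by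
    apply mul_le_mul_of_nonneg_left _ (by apply div_nonneg <;> linarith)
    linarith
  linarith

lemma tp_jensen {p : ℝ} (hp : 1 < p) (hp2 : p ≤ 2) (x h : ℂ) :
    ‖x‖ ^ p ≤ (‖x + h‖ ^ p + ‖x - h‖ ^ p) / 2 := by
  refine le_trans ?_ (tp_lower hp hp2 x h)
  rw [← sq_rpow_half (norm_nonneg x)]
  apply Real.rpow_le_rpow (by positivity) _ (by linarith)
  nlinarith [sq_nonneg ‖h‖]
end RR

namespace RR

section tree
variable {P : ℕ} [NeZero P]

lemma sum_shift {M : Type*} [AddCommMonoid M] (L : ZMod P) (F : ZMod P → M) :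
    ∑ a, F (a + L) = ∑ a, F a :=
  Fintype.sum_equiv (Equiv.addRight L) _ _ (fun _ => rfl)

noncomputable def av (f : ZMod P → ℂ) (j : ℕ) (a : ZMod P) : ℂ :=
  (∑ t ∈ Finset.range (2 ^ j), f (a + (t : ZMod P))) / 2 ^ j

lemma sum_split {M : Type*} [AddCommMonoid M] (j : ℕ) (F : ℕ → M) :
    ∑ t ∈ Finset.range (2 ^ (j + 1)), F t =
      ∑ t ∈ Finset.range (2 ^ j), F t + ∑ t ∈ Finset.range (2 ^ j), F (2 ^ j + t) := by
  rw [pow_succ, mul_two, Finset.sum_range_add]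

lemma cast_two_pow_add (a : ZMod P) (j t : ℕ) :
    a + ((2 ^ j + t : ℕ) : ZMod P) = a + 2 ^ j + (t : ZMod P) := by
  push_cast; ring

lemma av_succ (f : ZMod P → ℂ) (j : ℕ) (a : ZMod P) :
    av f (j + 1) a = (av f j a + av f j (a + 2 ^ j)) / 2 := by
  unfold av
  rw [sum_split]
  simp only [cast_two_pow_add]
  rw [pow_succ]
  field_simp

noncomputable def kk (c : ℕ → ℝ) (f : ZMod P → ℂ) (j : ℕ) (a : ZMod P) : ℂ :=
  (c (j + 1) : ℂ) * ((av f j a - av f j (a + 2 ^ j)) / 2) -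
    2 * ((c (j + 1) - c j : ℝ) : ℂ) * av f j a

noncomputable def W (c : ℕ → ℝ) (f : ZMod P → ℂ) : ℕ → ZMod P → ℕ → ℂ
  | 0, _, _ => 0
  | j + 1, a, t => if t < 2 ^ j then kk c f j a + W c f j a t
      else - kk c f j a + W c f j (a + 2 ^ j) (t - 2 ^ j)

lemma W_split {M : Type*} [AddCommMonoid M] (c : ℕ → ℝ) (f : ZMod P → ℂ) (j : ℕ) (a : ZMod P)
    (F : ZMod P → ℂ → M) :
    ∑ t ∈ Finset.range (2 ^ (j + 1)), F (a + (t : ZMod P)) (W c f (j + 1) a t) =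
      ∑ t ∈ Finset.range (2 ^ j), F (a + (t : ZMod P)) (kk c f j a + W c f j a t) +
      ∑ t ∈ Finset.range (2 ^ j), F (a + 2 ^ j + (t : ZMod P))
        (- kk c f j a + W c f j (a + 2 ^ j) t) := by
  rw [sum_split]
  congr 1
  · apply Finset.sum_congr rfl
    intro t ht
    rw [W, if_pos (Finset.mem_range.1 ht)]
  · apply Finset.sum_congr rfl
    intro t ht
    rw [W, if_neg (by omega), cast_two_pow_add, Nat.add_sub_cancel_left]

lemma jensen_av {p : ℝ} (hp : 1 < p) (hp2 : p ≤ 2) (f : ZMod P → ℂ) (j : ℕ) (a : ZMod P) :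
    ‖av f j a‖ ^ p ≤ (∑ t ∈ Finset.range (2 ^ j), ‖f (a + (t : ZMod P))‖ ^ p) / 2 ^ j := by
  induction j generalizing a with
  | zero => simp [av]
  | succ j ih =>
    have h1 := tp_jensen hp hp2 (av f (j + 1) a) ((av f j a - av f j (a + 2 ^ j)) / 2)
    have e1 : av f (j + 1) a + (av f j a - av f j (a + 2 ^ j)) / 2 = av f j a := by
      rw [av_succ]; ring
    have e2 : av f (j + 1) a - (av f j a - av f j (a + 2 ^ j)) / 2 = av f j (a + 2 ^ j) := by
      rw [av_succ]; ring
    rw [e1, e2] at h1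
    have i1 := ih a
    have i2 := ih (a + 2 ^ j)
    rw [sum_split]
    simp only [cast_two_pow_add]
    rw [pow_succ, ← div_div, add_div]
    linarith

lemma kk_bound (c : ℕ → ℝ) (hc0 : ∀ j, 0 ≤ c j) (hc1 : ∀ j, c j ≤ 1) (f : ZMod P → ℂ)
    (j : ℕ) (a : ZMod P) :
    ‖kk c f j a‖ ^ 2 ≤ 18 * ‖(av f j a - av f j (a + 2 ^ j)) / 2‖ ^ 2 +
      8 * (c (j + 1) - c j) ^ 2 * ‖av f (j + 1) a‖ ^ 2 := by
  set X := av f (j + 1) a with hX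
  set h := (av f j a - av f j (a + 2 ^ j)) / 2 with hh
  set b := c (j + 1) - c j with hb
  have e1 : av f j a = X + h := by rw [hX, hh, av_succ]; ring
  have hb1 : |b| ≤ 1 := by
    rw [abs_le]; constructor <;> linarith [hc0 j, hc1 j, hc0 (j + 1), hc1 (j + 1)]
  have h1 : ‖kk c f j a‖ ≤ 3 * ‖h‖ + 2 * |b| * ‖X‖ := by
    unfold kk
    rw [← hh, ← hb, e1]
    calc ‖(c (j + 1) : ℂ) * h - 2 * (b : ℂ) * (X + h)‖
        ≤ ‖(c (j + 1) : ℂ) * h‖ + ‖2 * (b : ℂ) * (X + h)‖ := norm_sub_le _ _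
      _ ≤ 1 * ‖h‖ + 2 * |b| * (‖X‖ + ‖h‖) := by
          gcongr
          · rw [norm_mul, Complex.norm_real, Real.norm_eq_abs, abs_of_nonneg (hc0 _)]
            gcongr
            exact hc1 _
          · rw [norm_mul, norm_mul, Complex.norm_real, Real.norm_eq_abs]
            simp only [Complex.norm_ofNat]
            gcongr
            exact norm_add_le _ _
      _ ≤ _ := by nlinarith [norm_nonneg h, abs_nonneg b]
  have h2 : ‖kk c f j a‖ ^ 2 ≤ (3 * ‖h‖ + 2 * |b| * ‖X‖) ^ 2 := by gcongr
  have h3 : b ^ 2 = |b| ^ 2 := (sq_abs b).symm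
  rw [h3]
  nlinarith [sq_nonneg (3 * ‖h‖ - 2 * |b| * ‖X‖)]

noncomputable def Gam (c : ℕ → ℝ) (n : ℕ) : ℝ :=
  ∏ i ∈ Finset.range n, (1 + 8 * (c (i + 1) - c i) ^ 2)

lemma Gam_pos (c : ℕ → ℝ) (n : ℕ) : 0 < Gam c n :=
  Finset.prod_pos fun i _ => by positivity

lemma bellman {p : ℝ} (hp : 1 < p) (hp2 : p ≤ 2) (c : ℕ → ℝ) (hc0 : ∀ j, 0 ≤ c j)
    (hc1 : ∀ j, c j ≤ 1) (f : ZMod P → ℂ) (j : ℕ) (a : ZMod P) (y : ℂ) :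
    (∑ t ∈ Finset.range (2 ^ j), ‖y + W c f j a t‖ ^ p) / 2 ^ j ≤
      Gam c j * ((‖av f j a‖ ^ 2 + ‖y‖ ^ 2) ^ (p / 2) + (18 + 1) / ((p - 1) / 2) *
        ((∑ t ∈ Finset.range (2 ^ j), ‖f (a + (t : ZMod P))‖ ^ p) / 2 ^ j - ‖av f j a‖ ^ p)) := by
  induction j generalizing a y with
  | zero =>
    simp only [pow_zero, Finset.range_one, Finset.sum_singleton, W, add_zero, div_one, av,
      Nat.cast_zero, sub_self, mul_zero, Gam, Finset.range_zero, Finset.prod_empty, one_mul]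
    rw [← sq_rpow_half (norm_nonneg y)]
    apply Real.rpow_le_rpow (by positivity) _ (by linarith)
    nlinarith [sq_nonneg ‖f a‖]
  | succ j ih =>
    set X := av f (j + 1) a with hX
    set h := (av f j a - av f j (a + 2 ^ j)) / 2 with hh
    set k := kk c f j a with hk
    set B : ℝ := (18 + 1) / ((p - 1) / 2) with hB
    have hB0 : 0 ≤ B := by rw [hB]; apply div_nonneg <;> linarith
    have e1 : av f j a = X + h := by rw [hX, hh, av_succ]; ring
    have e2 : av f j (a + 2 ^ j) = X - h := by rw [hX, hh, av_succ]; ring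
    have i1 := ih a (y + k)
    have i2 := ih (a + 2 ^ j) (y - k)
    have hs := bellman_step hp hp2 (x := X) (y := y) (h := h) (k := k) (C := 18)
      (d := 8 * (c (j + 1) - c j) ^ 2) (by norm_num) (by positivity)
      (kk_bound c hc0 hc1 f j a)
    have hj := jensen_av hp hp2 f (j + 1) a
    rw [e1] at i1
    rw [e2] at i2
    rw [W_split c f j a (fun _ w => ‖y + w‖ ^ p)]
    rw [sum_split] at hj ⊢
    simp only [cast_two_pow_add] at hj ⊢
    rw [← hX] at hj
    set A1 := ∑ t ∈ Finset.range (2 ^ j), ‖f (a + (t : ZMod P))‖ ^ p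
    set A2 := ∑ t ∈ Finset.range (2 ^ j), ‖f (a + 2 ^ j + (t : ZMod P))‖ ^ p
    have eG : Gam c (j + 1) = Gam c j * (1 + 8 * (c (j + 1) - c j) ^ 2) := by
      unfold Gam; rw [Finset.prod_range_succ]
    rw [eG]
    rw [← hB] at hs
    simp only [← hk, ← add_assoc]
    have e3 : ∀ w : ℂ, y + -k + w = y - k + w := fun w => by ring
    simp only [e3]
    set d := 8 * (c (j + 1) - c j) ^ 2 with hd
    have hd0 : 0 ≤ d := by positivity
    set S1 := ∑ t ∈ Finset.range (2 ^ j), ‖y + k + W c f j a t‖ ^ p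
    set S2 := ∑ t ∈ Finset.range (2 ^ j), ‖y - k + W c f j (a + 2 ^ j) t‖ ^ p
    have hG := Gam_pos c j
    set Γ := Gam c j
    have e4 : (S1 + S2) / 2 ^ (j + 1) = (S1 / 2 ^ j + S2 / 2 ^ j) / 2 := by
      rw [pow_succ]; field_simp
    have e5 : (A1 + A2) / 2 ^ (j + 1) = (A1 / 2 ^ j + A2 / 2 ^ j) / 2 := by
      rw [pow_succ]; field_simp
    rw [e5] at hj ⊢
    rw [e4]
    set G0 := (‖X‖ ^ 2 + ‖y‖ ^ 2) ^ (p / 2)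
    calc (S1 / 2 ^ j + S2 / 2 ^ j) / 2 ≤ Γ * (((‖X + h‖ ^ 2 + ‖y + k‖ ^ 2) ^ (p / 2) +
            (‖X - h‖ ^ 2 + ‖y - k‖ ^ 2) ^ (p / 2)) / 2 +
            B * ((A1 / 2 ^ j + A2 / 2 ^ j) / 2 - (‖X + h‖ ^ p + ‖X - h‖ ^ p) / 2)) := by
          linarith
      _ ≤ Γ * ((1 + d) * G0 + B * ((A1 / 2 ^ j + A2 / 2 ^ j) / 2 - ‖X‖ ^ p)) := by
          apply mul_le_mul_of_nonneg_left _ hG.le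
          linarith
      _ ≤ Γ * ((1 + d) * (G0 + B * ((A1 / 2 ^ j + A2 / 2 ^ j) / 2 - ‖X‖ ^ p))) := by
          apply mul_le_mul_of_nonneg_left _ hG.le
          have : 0 ≤ d * (B * ((A1 / 2 ^ j + A2 / 2 ^ j) / 2 - ‖X‖ ^ p)) := by
            apply mul_nonneg hd0 (mul_nonneg hB0 (by linarith))
          linarith
      _ = _ := by ring

lemma W_bound {p : ℝ} (hp : 1 < p) (hp2 : p ≤ 2) (c : ℕ → ℝ) (hc0 : ∀ j, 0 ≤ c j)
    (hc1 : ∀ j, c j ≤ 1) (f : ZMod P → ℂ) (n : ℕ) :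
    ∑ a : ZMod P, ∑ t ∈ Finset.range (2 ^ n), ‖W c f n a t‖ ^ p ≤
      Gam c n * (19 / ((p - 1) / 2)) * (2 ^ n * ∑ a : ZMod P, ‖f a‖ ^ p) := by
  have h1 : ∀ a : ZMod P, ∑ t ∈ Finset.range (2 ^ n), ‖W c f n a t‖ ^ p ≤
      Gam c n * (19 / ((p - 1) / 2)) * ∑ t ∈ Finset.range (2 ^ n), ‖f (a + (t : ZMod P))‖ ^ p := by
    intro a
    have hb := bellman hp hp2 c hc0 hc1 f n a 0
    simp only [zero_add, norm_zero] at hb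
    have hj := jensen_av hp hp2 f n a
    have hG := Gam_pos c n
    have e : (‖av f n a‖ ^ 2 + (0:ℝ) ^ 2) ^ (p / 2) = ‖av f n a‖ ^ p := by
      rw [← sq_rpow_half (norm_nonneg _)]; simp
    rw [e] at hb
    have e2 : ((18:ℝ) + 1) / ((p - 1) / 2) = 19 / ((p - 1) / 2) := by norm_num
    rw [e2] at hb
    have hB1 : 1 ≤ 19 / ((p - 1) / 2) := by
      rw [le_div_iff₀ (by linarith)]; linarith
    set B := 19 / ((p - 1) / 2)
    set A := ∑ t ∈ Finset.range (2 ^ n), ‖f (a + (t : ZMod P))‖ ^ p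
    have h2 : (∑ t ∈ Finset.range (2 ^ n), ‖W c f n a t‖ ^ p) / 2 ^ n ≤
        Gam c n * B * A / 2 ^ n := by
      refine hb.trans ?_
      rw [mul_assoc, mul_div_assoc]
      apply mul_le_mul_of_nonneg_left _ hG.le
      have : 0 ≤ (B - 1) * ‖av f n a‖ ^ p := mul_nonneg (by linarith) (by positivity)
      rw [mul_div_assoc]
      linarith
    exact (div_le_div_iff_of_pos_right (by positivity)).1 h2
  calc _ ≤ ∑ a : ZMod P, Gam c n * (19 / ((p - 1) / 2)) *
        ∑ t ∈ Finset.range (2 ^ n), ‖f (a + (t : ZMod P))‖ ^ p := Finset.sum_le_sum fun a _ => h1 a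
    _ = _ := by
      rw [← Finset.mul_sum, Finset.sum_comm]
      congr 1
      have : ∀ t ∈ Finset.range (2 ^ n), ∑ a : ZMod P, ‖f (a + (t : ZMod P))‖ ^ p =
          ∑ a : ZMod P, ‖f a‖ ^ p := fun t _ =>
        sum_shift (t : ZMod P) (fun a => ‖f a‖ ^ p)
      rw [Finset.sum_congr rfl this]
      simp

lemma beta_formula (c : ℕ → ℝ) (hc : c 0 = 0) (f g : ZMod P → ℂ) (n : ℕ) :
    (∑ a : ZMod P, ∑ t ∈ Finset.range (2 ^ n), g (a + (t : ZMod P)) * W c f n a t) / 2 ^ n =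
      ∑ i ∈ Finset.range n, ((c (i + 1) - c i : ℝ) : ℂ) *
        ∑ a : ZMod P, av f i a * av g i (a + 2 ^ i) - c n * ∑ a : ZMod P, av f n a * av g n a := by
  induction n with
  | zero => simp [W, hc]
  | succ j ih =>
    rw [Finset.sum_range_succ]
    set L : ZMod P := 2 ^ j with hL
    have hsh : ∀ F : ZMod P → ℂ, ∑ a, F (a + L) = ∑ a, F a := sum_shift L
    set BB := ∑ a : ZMod P, ∑ t ∈ Finset.range (2 ^ j), g (a + (t : ZMod P)) * W c f j a t with hBB
    have e0 : ∀ a : ZMod P, ∑ t ∈ Finset.range (2 ^ j), g (a + (t : ZMod P)) = 2 ^ j * av g j a := by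
      intro a; unfold av; field_simp
    have e1 : ∑ a : ZMod P, ∑ t ∈ Finset.range (2 ^ (j + 1)),
        g (a + (t : ZMod P)) * W c f (j + 1) a t =
        2 * BB + 2 ^ j * ∑ a, kk c f j a * (av g j a - av g j (a + L)) := by
      have : ∀ a : ZMod P, ∑ t ∈ Finset.range (2 ^ (j + 1)),
        g (a + (t : ZMod P)) * W c f (j + 1) a t =
          (∑ t ∈ Finset.range (2 ^ j), g (a + (t : ZMod P)) * W c f j a t) +
          (fun a' => ∑ t ∈ Finset.range (2 ^ j), g (a' + (t : ZMod P)) * W c f j a' t) (a + L) +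
          2 ^ j * (kk c f j a * (av g j a - av g j (a + L))) := by
        intro a
        rw [W_split c f j a (fun x w => g x * w)]
        simp only [mul_add, Finset.sum_add_distrib, ← Finset.sum_mul, e0, ← hL]
        ring
      rw [Finset.sum_congr rfl (fun a _ => this a), Finset.sum_add_distrib,
        Finset.sum_add_distrib,
        hsh (fun a' => ∑ t ∈ Finset.range (2 ^ j), g (a' + (t : ZMod P)) * W c f j a' t),
        ← Finset.mul_sum]
      ring
    rw [e1]
    have e2 : (2 * BB + 2 ^ j * ∑ a, kk c f j a * (av g j a - av g j (a + L))) / 2 ^ (j + 1) =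
      BB / 2 ^ j + (∑ a, kk c f j a * (av g j a - av g j (a + L))) / 2 := by
      rw [pow_succ]; field_simp
    rw [e2, ih]
    set D := ∑ a : ZMod P, av f j a * av g j a with hD
    set N := ∑ a : ZMod P, av f j a * av g j (a + L) with hN
    set N' := ∑ a : ZMod P, av f j (a + L) * av g j a with hN'
    have hDL : ∑ a : ZMod P, av f j (a + L) * av g j (a + L) = D :=
      hsh (fun a => av f j a * av g j a)
    have e3 : ∑ a : ZMod P, av f (j + 1) a * av g (j + 1) a = (2 * D + N + N') / 4 := by
      have : ∀ a : ZMod P, av f (j + 1) a * av g (j + 1) a =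
          (av f j a * av g j a + av f j (a + L) * av g j (a + L) + av f j a * av g j (a + L) +
          av f j (a + L) * av g j a) / 4 := by
        intro a; rw [av_succ, av_succ]; ring
      rw [Finset.sum_congr rfl (fun a _ => this a), ← Finset.sum_div, Finset.sum_add_distrib,
        Finset.sum_add_distrib, Finset.sum_add_distrib, hDL]
      ring
    have e4 : ∑ a, kk c f j a * (av g j a - av g j (a + L)) =
        (c (j + 1) : ℂ) / 2 * (2 * D - N - N') - 2 * ((c (j + 1) - c j : ℝ) : ℂ) * (D - N) := by
      have : ∀ a : ZMod P, kk c f j a * (av g j a - av g j (a + L)) =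
          (c (j + 1) : ℂ) / 2 * (av f j a * av g j a + av f j (a + L) * av g j (a + L) -
            av f j a * av g j (a + L) - av f j (a + L) * av g j a) -
          2 * ((c (j + 1) - c j : ℝ) : ℂ) * (av f j a * av g j a - av f j a * av g j (a + L)) := by
        intro a; unfold kk; ring
      rw [Finset.sum_congr rfl (fun a _ => this a), Finset.sum_sub_distrib, ← Finset.mul_sum,
        ← Finset.mul_sum, Finset.sum_sub_distrib, Finset.sum_sub_distrib, Finset.sum_sub_distrib,
        Finset.sum_add_distrib, hDL]
      ring
    rw [e3, e4]
    push_cast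
    ring

end tree
end RR

namespace RR

section zmod
variable {P : ℕ} [NeZero P]

noncomputable def Sh (P : ℕ) : Module.End ℂ (ZMod P → ℂ) := LinearMap.funLeft ℂ ℂ (fun x => x - 1)

lemma Sh_pow (k : ℕ) (f : ZMod P → ℂ) (x : ZMod P) : ((Sh P) ^ k) f x = f (x - k) := by
  induction k generalizing x with
  | zero => simp
  | succ k ih =>
    rw [pow_succ', Module.End.mul_apply]
    show ((Sh P) ^ k) f (x - 1) = _
    rw [ih]
    congr 1
    push_cast
    ring

noncomputable def alp (i : ℕ) : ℂ[X] := C (1 / 2 ^ i : ℂ) * ∑ t ∈ Finset.range (2 ^ i), X ^ t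

noncomputable def phi (c : ℕ → ℝ) (n : ℕ) : ℂ[X] :=
  ∑ i ∈ Finset.range n, C ((c (i + 1) - c i : ℝ) : ℂ) * (X * alp i * alp i)

lemma aeval_alp (i : ℕ) (f : ZMod P → ℂ) (x : ZMod P) :
    aeval (Sh P) (alp i) f x = av f i (x - 2 ^ i + 1) := by
  unfold alp av
  rw [← Finset.sum_range_reflect]
  simp only [map_mul, aeval_C, map_sum, map_pow, aeval_X]
  rw [Module.End.mul_apply, Module.algebraMap_end_apply, Pi.smul_apply, LinearMap.sum_apply,
    Finset.sum_apply, smul_eq_mul, one_div, inv_mul_eq_div]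
  congr 1
  apply Finset.sum_congr rfl
  intro t ht
  rw [Sh_pow]
  congr 1
  have ht := Finset.mem_range.1 ht
  have : ((2 ^ i - 1 - t : ℕ) : ZMod P) = (2 ^ i : ZMod P) - 1 - t := by
    rw [Nat.sub_sub, Nat.cast_sub (by omega)]
    push_cast
    ring
  rw [this]
  ring

lemma pair_Xalp (i : ℕ) (u g : ZMod P → ℂ) :
    ∑ x, aeval (Sh P) (X * alp i) u x * g x = ∑ x, u x * av g i (x + 1) := by
  have h1 : ∀ x, aeval (Sh P) (X * alp i) u x =
      (∑ t ∈ Finset.range (2 ^ i), u (x - (t + 1 : ℕ))) / 2 ^ i := by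
    intro x
    unfold alp
    simp only [map_mul, aeval_C, map_sum, map_pow, aeval_X]
    rw [← mul_assoc, Algebra.right_comm, ← Algebra.commutes, Module.End.mul_apply,
      Module.algebraMap_end_apply, Pi.smul_apply, Finset.mul_sum, LinearMap.sum_apply,
      Finset.sum_apply, smul_eq_mul, one_div, inv_mul_eq_div]
    congr 1
    apply Finset.sum_congr rfl
    intro t ht
    rw [← pow_succ', Sh_pow]
  simp only [h1]
  unfold av
  simp only [div_mul_eq_mul_div, mul_div_assoc', Finset.sum_mul, Finset.mul_sum, ← Finset.sum_div]
  congr 1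
  rw [Finset.sum_comm, Finset.sum_comm (s := (Finset.univ : Finset (ZMod P)))]
  apply Finset.sum_congr rfl
  intro t ht
  rw [← sum_shift ((t + 1 : ℕ) : ZMod P)]
  apply Finset.sum_congr rfl
  intro x _
  rw [add_sub_cancel_right]
  congr 2
  push_cast
  ring

lemma pair_N (i : ℕ) (f g : ZMod P → ℂ) :
    ∑ x, aeval (Sh P) (X * alp i * alp i) f x * g x =
      ∑ a, av f i a * av g i (a + 2 ^ i) := by
  rw [map_mul]
  simp only [Module.End.mul_apply]
  rw [pair_Xalp, ← sum_shift (2 ^ i - 1 : ZMod P)]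
  apply Finset.sum_congr rfl
  intro x _
  rw [aeval_alp]
  congr 2 <;> ring

lemma pair_phi (c : ℕ → ℝ) (n : ℕ) (f g : ZMod P → ℂ) :
    ∑ x, aeval (Sh P) (phi c n) f x * g x = ∑ i ∈ Finset.range n, ((c (i + 1) - c i : ℝ) : ℂ) *
        ∑ a : ZMod P, av f i a * av g i (a + 2 ^ i) := by
  unfold phi
  simp only [← pair_N]
  rw [map_sum]
  simp only [LinearMap.sum_apply, Finset.sum_apply, Finset.sum_mul]
  rw [Finset.sum_comm]
  apply Finset.sum_congr rfl
  intro i _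
  rw [Finset.mul_sum]
  apply Finset.sum_congr rfl
  intro x _
  rw [map_mul (aeval (Sh P)) (C _), aeval_C, Module.End.mul_apply, Module.algebraMap_end_apply,
    Pi.smul_apply, smul_eq_mul]
  ring

lemma pair_bound {p q : ℝ} (hpq : p.HolderConjugate q) (hp2 : p ≤ 2) (c : ℕ → ℝ)
    (hc0 : ∀ j, 0 ≤ c j) (hc1 : ∀ j, c j ≤ 1) (n : ℕ) (h0 : c 0 = 0) (hn : c n = 0)
    (f g : ZMod P → ℂ) :
    ‖∑ x, aeval (Sh P) (phi c n) f x * g x‖ ≤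
      (Gam c n * (19 / ((p - 1) / 2))) ^ (1 / p) *
        ((∑ x, ‖f x‖ ^ p) ^ (1 / p) * (∑ x, ‖g x‖ ^ q) ^ (1 / q)) := by
  have hp := hpq.lt
  have hq := hpq.symm.lt
  have hb := beta_formula c h0 f g n
  rw [hn, ← pair_phi] at hb
  simp only [Complex.ofReal_zero, zero_mul, sub_zero] at hb
  rw [← hb]
  have hW := W_bound hp hp2 c hc0 hc1 f n
  have hK : 0 ≤ Gam c n * (19 / ((p - 1) / 2)) := by
    apply mul_nonneg (Gam_pos c n).le
    apply div_nonneg <;> linarith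
  set K := Gam c n * (19 / ((p - 1) / 2))
  have hH := Real.inner_le_Lp_mul_Lq ((Finset.univ : Finset (ZMod P)) ×ˢ Finset.range (2 ^ n))
    (fun z => ‖W c f n z.1 z.2‖) (fun z => ‖g (z.1 + (z.2 : ZMod P))‖) hpq
  simp only [Finset.sum_product, abs_norm] at hH
  have hg : ∑ a : ZMod P, ∑ t ∈ Finset.range (2 ^ n), ‖g (a + (t : ZMod P))‖ ^ q =
      2 ^ n * ∑ a, ‖g a‖ ^ q := by
    rw [Finset.sum_comm]
    have : ∀ t ∈ Finset.range (2 ^ n), ∑ a : ZMod P, ‖g (a + (t : ZMod P))‖ ^ q =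
        ∑ a : ZMod P, ‖g a‖ ^ q := fun t _ => sum_shift (t : ZMod P) (fun a => ‖g a‖ ^ q)
    rw [Finset.sum_congr rfl this]
    simp
  rw [hg] at hH
  rw [norm_div, norm_pow, Complex.norm_ofNat, div_le_iff₀ (by positivity)]
  have hF : 0 ≤ ∑ a : ZMod P, ‖f a‖ ^ p := Finset.sum_nonneg fun _ _ => by positivity
  have hGq : 0 ≤ ∑ a : ZMod P, ‖g a‖ ^ q := Finset.sum_nonneg fun _ _ => by positivity
  calc ‖∑ a : ZMod P, ∑ t ∈ Finset.range (2 ^ n), g (a + (t : ZMod P)) * W c f n a t‖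
      ≤ ∑ a : ZMod P, ∑ t ∈ Finset.range (2 ^ n), ‖W c f n a t‖ * ‖g (a + (t : ZMod P))‖ := by
        refine (norm_sum_le _ _).trans (Finset.sum_le_sum fun a _ => ?_)
        refine (norm_sum_le _ _).trans (Finset.sum_le_sum fun t _ => ?_)
        rw [norm_mul, mul_comm]
    _ ≤ _ := hH
    _ ≤ (K * (2 ^ n * ∑ a : ZMod P, ‖f a‖ ^ p)) ^ (1 / p) *
          (2 ^ n * ∑ a : ZMod P, ‖g a‖ ^ q) ^ (1 / q) := by
        gcongr
    _ = _ := by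
        rw [Real.mul_rpow hK (by positivity), Real.mul_rpow (by positivity) hF,
          Real.mul_rpow (by positivity) hGq]
        have : ((2:ℝ) ^ n) ^ (1 / p) * ((2:ℝ) ^ n) ^ (1 / q) = 2 ^ n := by
          rw [← Real.rpow_add (by positivity)]
          rw [one_div, one_div, hpq.inv_add_inv_eq_one, Real.rpow_one]
        linear_combination K ^ (1 / p) * (∑ a : ZMod P, ‖f a‖ ^ p) ^ (1 / p) *
          (∑ a : ZMod P, ‖g a‖ ^ q) ^ (1 / q) * this

lemma pair_flip (φ : ℂ[X]) (f g : ZMod P → ℂ) :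
    ∑ x, aeval (Sh P) φ f x * g x =
      ∑ x, aeval (Sh P) φ (fun y => g (-y)) x * f (-x) := by
  rw [aeval_eq_sum_range]
  simp only [LinearMap.sum_apply, Finset.sum_apply, LinearMap.smul_apply, Pi.smul_apply,
    Sh_pow, Finset.sum_mul, smul_eq_mul]
  rw [Finset.sum_comm, Finset.sum_comm (s := (Finset.univ : Finset (ZMod P)))]
  apply Finset.sum_congr rfl
  intro k _
  refine Fintype.sum_equiv (Equiv.subLeft (k : ZMod P)) _ _ ?_
  intro x
  simp only [Equiv.subLeft_apply, sub_sub_cancel_left, neg_neg, neg_sub]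
  ring

lemma sum_neg_comp (F : ZMod P → ℝ) : ∑ x, F (-x) = ∑ x, F x :=
  Fintype.sum_equiv (Equiv.neg _) _ _ (fun _ => rfl)

/-- from pairings to norms -/
lemma norm_of_pair {p q : ℝ} (hpq : p.HolderConjugate q) {K A : ℝ} (hKA : 0 ≤ K * A)
    (u : ZMod P → ℂ)
    (h : ∀ g : ZMod P → ℂ, ‖∑ x, u x * g x‖ ≤ K * (A * (∑ x, ‖g x‖ ^ q) ^ (1 / q))) :
    (∑ x, ‖u x‖ ^ p) ^ (1 / p) ≤ K * A := by
  have hp := hpq.lt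
  have hq := hpq.symm.lt
  have h1 := h (fun x => (starRingEnd ℂ) (u x) * ((‖u x‖ ^ (p - 2) : ℝ) : ℂ))
  have e1 : ∀ x, u x * ((starRingEnd ℂ) (u x) * ((‖u x‖ ^ (p - 2) : ℝ) : ℂ)) =
      ((‖u x‖ ^ p : ℝ) : ℂ) := by
    intro x
    rw [← mul_assoc, Complex.mul_conj, Complex.normSq_eq_norm_sq]
    norm_cast
    rcases eq_or_ne ‖u x‖ 0 with h0 | h0
    · rw [h0]; simp [Real.zero_rpow (show p ≠ 0 by linarith)]
    · rw [← Real.rpow_natCast, ← Real.rpow_add (by positivity)]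
      congr 1; push_cast; ring
  have e2 : ∀ x, ‖(starRingEnd ℂ) (u x) * ((‖u x‖ ^ (p - 2) : ℝ) : ℂ)‖ ^ q = ‖u x‖ ^ p := by
    intro x
    rw [norm_mul, RCLike.norm_conj, Complex.norm_real, Real.norm_of_nonneg (by positivity)]
    rcases eq_or_ne ‖u x‖ 0 with h0 | h0
    · rw [h0]; simp [Real.zero_rpow (show p ≠ 0 by linarith), Real.zero_rpow (show q ≠ 0 by linarith)]
    · have : ‖u x‖ * ‖u x‖ ^ (p - 2) = ‖u x‖ ^ (p - 1) := by
        nth_rewrite 1 [← Real.rpow_one ‖u x‖]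
        rw [← Real.rpow_add (by positivity)]; congr 1; ring
      rw [this, ← Real.rpow_mul (norm_nonneg _)]
      congr 1
      have := hpq.sub_one_mul_conj
      linarith
  simp only [e1, e2] at h1
  rw [← Complex.ofReal_sum, Complex.norm_real] at h1
  have hS : 0 ≤ ∑ x, ‖u x‖ ^ p := Finset.sum_nonneg fun _ _ => by positivity
  rw [Real.norm_of_nonneg hS] at h1
  set S := ∑ x, ‖u x‖ ^ p
  rcases hS.eq_or_lt with h0 | h0
  · rw [← h0, Real.zero_rpow (by positivity)]; exact hKA
  · have : S = S ^ (1 / p) * S ^ (1 / q) := by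
      rw [← Real.rpow_add h0, one_div, one_div, hpq.inv_add_inv_eq_one, Real.rpow_one]
    have hSq : 0 < S ^ (1 / q) := by positivity
    nth_rewrite 1 [this] at h1
    rw [← mul_assoc] at h1
    exact le_of_mul_le_mul_right h1 hSq

/-- the constant -/
noncomputable def Kc (p G : ℝ) : ℝ :=
  max ((G * (19 / ((p - 1) / 2))) ^ (1 / p))
    ((G * (19 / ((p.conjExponent - 1) / 2))) ^ (1 / p.conjExponent))

lemma zmod_bound {p : ℝ} (hp : 1 < p) (c : ℕ → ℝ)
    (hc0 : ∀ j, 0 ≤ c j) (hc1 : ∀ j, c j ≤ 1) (n : ℕ) (h0 : c 0 = 0) (hn : c n = 0)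
    {G : ℝ} (hG : Gam c n ≤ G) (f : ZMod P → ℂ) :
    (∑ x, ‖aeval (Sh P) (phi c n) f x‖ ^ p) ^ (1 / p) ≤
      Kc p G * (∑ x, ‖f x‖ ^ p) ^ (1 / p) := by
  have hpq := Real.HolderConjugate.conjExponent hp
  unfold Kc
  set q := p.conjExponent
  have hq := hpq.symm.lt
  have hG0 : 0 < G := (Gam_pos c n).trans_le hG
  have hF : 0 ≤ (∑ x, ‖f x‖ ^ p) ^ (1 / p) :=
    Real.rpow_nonneg (Finset.sum_nonneg fun _ _ => by positivity) _
  have mono : ∀ r : ℝ, 1 < r → (Gam c n * (19 / ((r - 1) / 2))) ^ (1 / r) ≤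
      (G * (19 / ((r - 1) / 2))) ^ (1 / r) := by
    intro r hr
    have hr' : 0 < (r - 1) / 2 := by linarith
    have := (Gam_pos c n).le
    apply Real.rpow_le_rpow (by positivity) _ (by positivity)
    gcongr
  have hK0 : ∀ r : ℝ, 1 < r → 0 ≤ (G * (19 / ((r - 1) / 2))) ^ (1 / r) := by
    intro r hr
    have hr' : 0 < (r - 1) / 2 := by linarith
    positivity
  apply norm_of_pair hpq (mul_nonneg ((hK0 p hp).trans (le_max_left _ _)) hF)
  intro g
  have hGg : 0 ≤ (∑ x, ‖g x‖ ^ q) ^ (1 / q) :=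
    Real.rpow_nonneg (Finset.sum_nonneg fun _ _ => by positivity) _
  rcases le_total p 2 with h2 | h2
  · refine (pair_bound hpq h2 c hc0 hc1 n h0 hn f g).trans ?_
    apply mul_le_mul_of_nonneg_right _ (by positivity)
    exact (mono p hp).trans (le_max_left _ _)
  · have hq2 : q ≤ 2 := by
      have := hpq.sub_one_mul_conj
      have h3 := hpq.symm.sub_one_mul_conj
      nlinarith
    rw [pair_flip]
    refine (pair_bound hpq.symm hq2 c hc0 hc1 n h0 hn (fun y => g (-y)) (fun x => f (-x))).trans ?_
    rw [sum_neg_comp (fun x => ‖f x‖ ^ p), sum_neg_comp (fun x => ‖g x‖ ^ q), 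
      mul_comm ((∑ x, ‖g x‖ ^ q) ^ (1 / q))]
    apply mul_le_mul_of_nonneg_right _ (by positivity)
    exact (mono q hq).trans (le_max_right _ _)

end zmod
end RR

namespace RR

lemma sum_zmod_val {P : ℕ} [NeZero P] {M : Type*} [AddCommMonoid M] (G : ℕ → M) :
    ∑ x : ZMod P, G x.val = ∑ r ∈ Finset.range P, G r := by
  refine Finset.sum_nbij' (fun x => x.val) (fun r => (r : ZMod P)) ?_ ?_ ?_ ?_ ?_
  · intro x _; exact Finset.mem_range.2 (ZMod.val_lt x)
  · intro r _; exact Finset.mem_univ _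
  · intro x _; exact ZMod.natCast_zmod_val x
  · intro r hr; exact ZMod.val_natCast_of_lt (Finset.mem_range.1 hr)
  · intro x _; rfl

lemma window {p K : ℝ} (hp : 1 < p) (hK : 0 ≤ K) (φ : ℂ[X]) {P : ℕ} [NeZero P]
    (h : ∀ f : ZMod P → ℂ, (∑ x, ‖aeval (Sh P) φ f x‖ ^ p) ^ (1 / p) ≤
      K * (∑ x, ‖f x‖ ^ p) ^ (1 / p)) (F : ℤ → ℂ) (m : ℤ) :
    ∑ r ∈ Finset.Ico φ.natDegree P,
      ‖∑ i ∈ Finset.range (φ.natDegree + 1), φ.coeff i * F (m + r - i)‖ ^ p ≤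
      K ^ p * ∑ r ∈ Finset.range P, ‖F (m + r)‖ ^ p := by
  have h1 := h (fun x => F (m + x.val))
  rw [sum_zmod_val (fun r => ‖F (m + r)‖ ^ p)] at h1
  have hA : 0 ≤ ∑ r ∈ Finset.range P, ‖F (m + r)‖ ^ p := Finset.sum_nonneg fun _ _ => by positivity
  set A := ∑ r ∈ Finset.range P, ‖F (m + r)‖ ^ p
  have hS : 0 ≤ ∑ x, ‖aeval (Sh P) φ (fun x => F (m + x.val)) x‖ ^ p :=
    Finset.sum_nonneg fun _ _ => by positivity
  have h2 : ∑ x, ‖aeval (Sh P) φ (fun x => F (m + x.val)) x‖ ^ p ≤ K ^ p * A := by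
    have := Real.rpow_le_rpow (by positivity) h1 (show 0 ≤ p by linarith)
    rwa [← Real.rpow_mul hS, one_div_mul_cancel (by linarith), Real.rpow_one,
      Real.mul_rpow hK (by positivity), ← Real.rpow_mul hA, one_div_mul_cancel (by linarith),
      Real.rpow_one] at this
  refine le_trans ?_ h2
  have h3 : ∑ x, ‖aeval (Sh P) φ (fun x => F (m + x.val)) x‖ ^ p =
      ∑ r ∈ Finset.range P, ‖aeval (Sh P) φ (fun x => F (m + x.val)) (r : ZMod P)‖ ^ p := by
    rw [← sum_zmod_val (fun r => ‖aeval (Sh P) φ (fun x => F (m + x.val)) (r : ZMod P)‖ ^ p)]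
    simp
  rw [h3]
  have hsub : Finset.Ico φ.natDegree P ⊆ Finset.range P := by
    intro r hr; exact Finset.mem_range.2 (Finset.mem_Ico.1 hr).2
  refine le_trans (le_of_eq ?_) (Finset.sum_le_sum_of_subset_of_nonneg hsub
    (fun _ _ _ => by positivity))
  apply Finset.sum_congr rfl
  intro r hr
  obtain ⟨hr1, hr2⟩ := Finset.mem_Ico.1 hr
  rw [aeval_eq_sum_range]
  simp only [LinearMap.sum_apply, Finset.sum_apply, LinearMap.smul_apply, Pi.smul_apply,
    Sh_pow, smul_eq_mul]
  congr 2
  apply Finset.sum_congr rfl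
  intro i hi
  have hi := Finset.mem_range.1 hi
  congr 2
  have : ((r : ZMod P) - (i : ZMod P)) = ((r - i : ℕ) : ZMod P) := by
    rw [Nat.cast_sub (by omega)]
  rw [this, ZMod.val_natCast_of_lt (by omega)]
  push_cast [show i ≤ r by omega]
  ring

section
variable {Q : ℝ≥0∞} [Fact (1 ≤ Q)]

lemma shiftOp_pow_apply (k : ℕ) (f : Lp ℂ Q (Measure.count : Measure ℤ)) (x : ℤ) :
    ((shiftOp Q) ^ k) f x = f (x - k) := by
  induction k generalizing x with
  | zero => simp
  | succ k ih =>
    rw [pow_succ', mul_apply_eq_comp]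
    have := Measure.ae_count_iff.1 (Lp.coeFn_compMeasurePreserving
      (((shiftOp Q) ^ k) f) shift_measurePreserving) x
    have h2 : (shiftOp Q) (((shiftOp Q) ^ k) f) x =
      (Lp.compMeasurePreserving (fun k : ℤ => k - 1) shift_measurePreserving
        (((shiftOp Q) ^ k) f)) x := rfl
    rw [h2, this, Function.comp_apply, ih]
    congr 1
    push_cast
    ring

lemma aeval_shiftOp_apply (φ : ℂ[X]) (f : Lp ℂ Q (Measure.count : Measure ℤ)) (x : ℤ) :
    aeval (shiftOp Q) φ f x =
      ∑ i ∈ Finset.range (φ.natDegree + 1), φ.coeff i * f (x - i) := by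
  rw [aeval_eq_sum_range]
  generalize φ.natDegree + 1 = N
  induction N with
  | zero =>
    simp only [Finset.range_zero, Finset.sum_empty, zero_apply]
    exact Measure.ae_count_iff.1 (Lp.coeFn_zero ℂ Q Measure.count) x
  | succ N ih =>
    rw [Finset.sum_range_succ, Finset.sum_range_succ, add_apply, ← ih,
      smul_apply, ← shiftOp_pow_apply]
    rw [Measure.ae_count_iff.1 (Lp.coeFn_add _ _) x, Pi.add_apply,
      Measure.ae_count_iff.1 (Lp.coeFn_smul _ _) x, Pi.smul_apply, smul_eq_mul]

end

lemma shift_bound {p : ℝ} [Fact (1 ≤ ENNReal.ofReal p)] (hp : 1 < p) {K : ℝ} (hK : 0 ≤ K)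
    (φ : ℂ[X])
    (h : ∀ (P : ℕ) [NeZero P] (f : ZMod P → ℂ), (∑ x, ‖aeval (Sh P) φ f x‖ ^ p) ^ (1 / p) ≤
      K * (∑ x, ‖f x‖ ^ p) ^ (1 / p)) :
    ‖aeval (shiftOp (ENNReal.ofReal p)) φ‖ ≤ K := by
  have hp0 : 0 < p := by linarith
  apply ContinuousLinearMap.opNorm_le_bound _ hK
  intro f
  set g := aeval (shiftOp (ENNReal.ofReal p)) φ f with hg
  have hQ0 : ENNReal.ofReal p ≠ 0 := by simpa using hp0
  have key : eLpNorm g (ENNReal.ofReal p) Measure.count ≤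
      ENNReal.ofReal K * eLpNorm f (ENNReal.ofReal p) Measure.count := by
    rw [eLpNorm_eq_lintegral_rpow_enorm_toReal hQ0 ENNReal.ofReal_ne_top,
      eLpNorm_eq_lintegral_rpow_enorm_toReal hQ0 ENNReal.ofReal_ne_top,
      ENNReal.toReal_ofReal hp0.le, lintegral_count, lintegral_count]
    have e0 : ENNReal.ofReal K = (ENNReal.ofReal K ^ p) ^ (1 / p) := by
      rw [← ENNReal.rpow_mul, mul_one_div_cancel hp0.ne', ENNReal.rpow_one]
    rw [e0, ← ENNReal.mul_rpow_of_nonneg _ _ (by positivity)]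
    apply ENNReal.rpow_le_rpow _ (by positivity)
    rw [ENNReal.tsum_eq_iSup_sum]
    apply iSup_le
    intro s
    obtain ⟨M, hM⟩ : ∃ M : ℕ, ∀ x ∈ s, x.natAbs < M := by
      refine ⟨s.sup Int.natAbs + 1, fun x hx => ?_⟩
      exact Nat.lt_succ_of_le (Finset.le_sup (f := Int.natAbs) hx)
    set d := φ.natDegree with hd
    have : NeZero (2 * M + d + 1) := ⟨by omega⟩
    have hw := window hp hK φ (h (2 * M + d + 1)) (f : ℤ → ℂ) (-(M : ℤ) - d)
    have hconv : ∀ z : ℂ, ‖z‖ₑ ^ p = ENNReal.ofReal (‖z‖ ^ p) := by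
      intro z
      rw [← ofReal_norm, ENNReal.ofReal_rpow_of_nonneg (norm_nonneg _) hp0.le]
    have hw2 := ENNReal.ofReal_le_ofReal hw
    rw [ENNReal.ofReal_sum_of_nonneg (fun _ _ => by positivity),
      ENNReal.ofReal_mul (by positivity),
      ENNReal.ofReal_sum_of_nonneg (fun _ _ => by positivity),
      ← ENNReal.ofReal_rpow_of_nonneg hK hp0.le] at hw2
    simp only [← hconv, ← aeval_shiftOp_apply, ← hg] at hw2
    have h1 : ∑ x ∈ s, ‖g x‖ₑ ^ p ≤
        ∑ r ∈ Finset.Ico d (2 * M + d + 1), ‖g (-(M : ℤ) - d + r)‖ₑ ^ p := by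
      have hinj : Set.InjOn (fun r : ℕ => (-(M : ℤ) - d + r)) (Finset.Ico d (2 * M + d + 1)) := by
        intro a _ b _ hab
        simp only at hab
        omega
      rw [← Finset.sum_image (f := fun x => ‖g x‖ₑ ^ p) hinj]
      apply Finset.sum_le_sum_of_subset
      intro x hx
      have := hM x hx
      rw [Finset.mem_image]
      refine ⟨(x + M + d).toNat, ?_, ?_⟩
      · rw [Finset.mem_Ico]; omega
      · omega
    have h2 : ∑ r ∈ Finset.range (2 * M + d + 1), ‖f (-(M : ℤ) - d + r)‖ₑ ^ p ≤
        ∑' x, ‖f x‖ₑ ^ p := by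
      have hinj : Set.InjOn (fun r : ℕ => (-(M : ℤ) - d + r)) (Finset.range (2 * M + d + 1)) := by
        intro a _ b _ hab
        simp only at hab
        omega
      rw [← Finset.sum_image (f := fun x => ‖f x‖ₑ ^ p) hinj]
      exact ENNReal.sum_le_tsum _
    exact h1.trans (hw2.trans (by gcongr))
  rw [Lp.norm_def, Lp.norm_def]
  have := ENNReal.toReal_mono (ENNReal.mul_ne_top ENNReal.ofReal_ne_top (Lp.eLpNorm_ne_top f)) key
  rwa [ENNReal.toReal_mul, ENNReal.toReal_ofReal hK] at this

end RR

namespace RR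

noncomputable def cc (j : ℕ) : ℝ := (1 - Real.cos (Real.pi * Real.logb 2 (1 + j / 64))) / 2

def rho (s : ℕ) : ℕ := 64 * (2 ^ s - 1)

noncomputable def nu (s : ℕ) : ℝ := 1 - 1 / 2 ^ rho s

lemma cc_nonneg (j : ℕ) : 0 ≤ cc j := by
  unfold cc; linarith [Real.cos_le_one (Real.pi * Real.logb 2 (1 + j / 64))]

lemma cc_le_one (j : ℕ) : cc j ≤ 1 := by
  unfold cc; linarith [Real.neg_one_le_cos (Real.pi * Real.logb 2 (1 + j / 64))]

lemma cc_rho (s : ℕ) : cc (rho s) = (1 - (-1) ^ s) / 2 := by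
  unfold cc rho
  have h : (1 : ℝ) + ((64 * (2 ^ s - 1) : ℕ) : ℝ) / 64 = 2 ^ s := by
    have : 1 ≤ 2 ^ s := Nat.one_le_two_pow
    push_cast [this]
    ring
  rw [h, Real.logb_pow, Real.logb_self_eq_one (by norm_num), mul_one, mul_comm,
    Real.cos_nat_mul_pi]

lemma cc_diff (j : ℕ) : |cc (j + 1) - cc j| ≤ 3 / (j + 64) := by
  unfold cc
  have hl : 0 < Real.log 2 := Real.log_pos (by norm_num)
  have h1 : Real.logb 2 (1 + ((j + 1 : ℕ) : ℝ) / 64) - Real.logb 2 (1 + j / 64) =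
      Real.log (1 + 1 / (j + 64)) / Real.log 2 := by
    unfold Real.logb
    rw [← sub_div, ← Real.log_div (by positivity) (by positivity)]
    congr 2
    push_cast
    field_simp
    ring
  have h2 : Real.log (1 + 1 / ((j:ℝ) + 64)) ≤ 1 / (j + 64) := by
    have := Real.log_le_sub_one_of_pos (show (0:ℝ) < 1 + 1 / (j + 64) by positivity)
    linarith
  have h3 : 0 ≤ Real.log (1 + 1 / ((j:ℝ) + 64)) :=
    Real.log_nonneg (by have : (0:ℝ) ≤ 1 / (j + 64) := by positivity
                        linarith)
  have hcos : ∀ a b : ℝ, |Real.cos a - Real.cos b| ≤ |a - b| := by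
    intro a b
    have := Real.lipschitzWith_cos.dist_le_mul a b
    simpa [Real.dist_eq] using this
  set A := Real.logb 2 (1 + ((j + 1 : ℕ) : ℝ) / 64)
  set B := Real.logb 2 (1 + (j : ℝ) / 64)
  have h4 := hcos (Real.pi * A) (Real.pi * B)
  rw [← mul_sub, h1, abs_of_nonneg (a := Real.pi * _) (mul_nonneg Real.pi_pos.le
    (div_nonneg h3 hl.le))] at h4
  have e : (1 - Real.cos (Real.pi * A)) / 2 - (1 - Real.cos (Real.pi * B)) / 2 =
      -((Real.cos (Real.pi * A) - Real.cos (Real.pi * B)) / 2) := by ring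
  rw [e, abs_neg, abs_div, abs_two]
  have h5 : Real.pi * (Real.log (1 + 1 / ((j:ℝ) + 64)) / Real.log 2) ≤ 6 * (1 / (j + 64)) := by
    calc Real.pi * (Real.log (1 + 1 / ((j:ℝ) + 64)) / Real.log 2)
        = Real.pi / Real.log 2 * Real.log (1 + 1 / ((j:ℝ) + 64)) := by ring
      _ ≤ 6 * (1 / (j + 64)) := by
        apply mul_le_mul _ h2 h3 (by norm_num)
        rw [div_le_iff₀ hl]
        have := Real.log_two_gt_d9
        have := Real.pi_lt_d2
        linarith
  have e2 : (3:ℝ) / (j + 64) = (6 * (1 / (j + 64))) / 2 := by ring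
  rw [e2]
  linarith

lemma sum_sq_cc (n : ℕ) : ∑ i ∈ Finset.range n, 8 * (cc (i + 1) - cc i) ^ 2 ≤ 2 := by
  have h : ∀ n : ℕ, ∑ i ∈ Finset.range n, 8 * (cc (i + 1) - cc i) ^ 2 ≤
      (72:ℝ) / 63 - 72 / ((n:ℝ) + 63) := by
    intro n
    induction n with
    | zero => simp
    | succ n ih =>
      rw [Finset.sum_range_succ]
      have h1 : (cc (n + 1) - cc n) ^ 2 ≤ (3 / (n + 64)) ^ 2 := by
        rw [← sq_abs]
        have := cc_diff n
        gcongr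
      have h2 : 8 * ((3:ℝ) / (n + 64)) ^ 2 ≤ 72 / (n + 63) - 72 / (n + 64) := by
        rw [div_sub_div _ _ (by positivity) (by positivity), div_pow, mul_div_assoc',
          div_le_div_iff₀ (by positivity) (by positivity)]
        have : (0:ℝ) ≤ n := by positivity
        nlinarith
      push_cast
      have e : (n:ℝ) + 1 + 63 = n + 64 := by ring
      rw [e]
      linarith
  refine (h n).trans ?_
  have : (0:ℝ) ≤ 72 / (n + 63) := by positivity
  linarith

lemma Gam_cc (n : ℕ) : Gam cc n ≤ Real.exp 2 := by
  unfold Gam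
  calc ∏ i ∈ Finset.range n, (1 + 8 * (cc (i + 1) - cc i) ^ 2)
      ≤ ∏ i ∈ Finset.range n, Real.exp (8 * (cc (i + 1) - cc i) ^ 2) := by
        apply Finset.prod_le_prod
        · intro i _; positivity
        · intro i _
          have := Real.add_one_le_exp (8 * (cc (i + 1) - cc i) ^ 2)
          linarith
    _ = Real.exp (∑ i ∈ Finset.range n, 8 * (cc (i + 1) - cc i) ^ 2) := (Real.exp_sum _ _).symm
    _ ≤ _ := Real.exp_le_exp.2 (sum_sq_cc n)

noncomputable def alr (x : ℝ) (i : ℕ) : ℝ := (∑ t ∈ Finset.range (2 ^ i), x ^ t) / 2 ^ i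

lemma eval_phi (c : ℕ → ℝ) (n : ℕ) (x : ℝ) :
    eval (x : ℂ) (phi c n) =
      ((∑ i ∈ Finset.range n, (c (i + 1) - c i) * (x * alr x i ^ 2) : ℝ) : ℂ) := by
  unfold phi alp alr
  simp only [eval_finsetSum, eval_mul, eval_C, eval_X, eval_pow]
  push_cast
  apply Finset.sum_congr rfl
  intro i _
  ring

lemma alr_nonneg {x : ℝ} (hx : 0 ≤ x) (i : ℕ) : 0 ≤ alr x i := by
  unfold alr; positivity

lemma alr_le_one {x : ℝ} (hx : 0 ≤ x) (hx1 : x ≤ 1) (i : ℕ) : alr x i ≤ 1 := by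
  unfold alr
  rw [div_le_one (by positivity)]
  calc ∑ t ∈ Finset.range (2 ^ i), x ^ t ≤ ∑ t ∈ Finset.range (2 ^ i), (1:ℝ) :=
        Finset.sum_le_sum fun t _ => pow_le_one₀ hx hx1
    _ = _ := by simp

lemma nu_nonneg (s : ℕ) : 0 ≤ nu s := by
  unfold nu
  rw [sub_nonneg, div_le_one (by positivity)]
  exact one_le_pow₀ (by norm_num)

lemma nu_le_one (s : ℕ) : nu s ≤ 1 := by
  unfold nu
  have : (0:ℝ) ≤ 1 / 2 ^ rho s := by positivity
  linarith

lemma rho_mono : Monotone rho := by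
  intro a b h
  unfold rho
  have := Nat.pow_le_pow_right (show 0 < 2 by norm_num) h
  omega

lemma nu_mono : Monotone nu := by
  intro a b h
  unfold nu
  have := rho_mono h
  gcongr
  norm_num

lemma alr_lower {ε : ℝ} (h0 : 0 ≤ ε) (h1 : ε ≤ 1) (i : ℕ) : 1 - 2 ^ i * ε ≤ alr (1 - ε) i := by
  unfold alr
  rw [le_div_iff₀ (by positivity)]
  calc (1 - 2 ^ i * ε) * 2 ^ i = ∑ t ∈ Finset.range (2 ^ i), (1 - 2 ^ i * ε) := by
        simp; ring
    _ ≤ _ := by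
      apply Finset.sum_le_sum
      intro t ht
      have hb := one_add_mul_le_pow (show (-2:ℝ) ≤ -ε by linarith) t
      have ht : (t : ℝ) ≤ 2 ^ i := by exact_mod_cast (Finset.mem_range.1 ht).le
      rw [← sub_eq_add_neg] at hb
      nlinarith

lemma alr_upper {ε : ℝ} (h0 : 0 < ε) (h1 : ε ≤ 1) (i : ℕ) : alr (1 - ε) i ≤ 1 / (2 ^ i * ε) := by
  unfold alr
  have hg := geom_sum_mul (1 - ε) (2 ^ i)
  have hpow : 0 ≤ (1 - ε) ^ (2 ^ i) := by
    apply pow_nonneg; linarith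
  rw [div_le_div_iff₀ (by positivity) (by positivity)]
  have : (∑ t ∈ Finset.range (2 ^ i), (1 - ε) ^ t) * ε ≤ 1 := by linarith
  have h2 : (0:ℝ) < 2 ^ i := by positivity
  nlinarith

lemma eval_close (s n : ℕ) (hn : rho s ≤ n) :
    ‖eval (nu s : ℂ) (phi cc n) - ((cc (rho s) : ℝ) : ℂ)‖ ≤ 1 / 4 := by
  rw [eval_phi, ← Complex.ofReal_sub, Complex.norm_real, Real.norm_eq_abs]
  obtain ⟨m, rfl⟩ := Nat.exists_eq_add_of_le hn
  set r := rho s with hr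
  set x := nu s with hx
  have hx0 : 0 ≤ x := nu_nonneg s
  have hx1 : x ≤ 1 := nu_le_one s
  set ε : ℝ := 1 / 2 ^ r with hε
  have hxe : x = 1 - ε := rfl
  have hε0 : 0 < ε := by positivity
  have hε1 : ε ≤ 1 := by linarith
  have hc : cc r = ∑ i ∈ Finset.range r, (cc (i + 1) - cc i) := by
    rw [Finset.sum_range_sub]
    have : cc 0 = 0 := by unfold cc; simp
    rw [this, sub_zero]
  have hb : ∀ j, |cc (j + 1) - cc j| ≤ 3 / 64 := by
    intro j
    refine (cc_diff j).trans ?_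
    gcongr
    have : (0:ℝ) ≤ j := by positivity
    linarith
  rw [Finset.sum_range_add, hc, add_sub_right_comm, ← Finset.sum_sub_distrib]
  have h1 : |∑ i ∈ Finset.range r, ((cc (i + 1) - cc i) * (x * alr x i ^ 2) - (cc (i + 1) - cc i))| ≤
      3 / 64 * 3 := by
    calc _ ≤ ∑ i ∈ Finset.range r, |(cc (i + 1) - cc i) * (x * alr x i ^ 2) - (cc (i + 1) - cc i)| :=
          Finset.abs_sum_le_sum_abs _ _
      _ ≤ ∑ i ∈ Finset.range r, 3 / 64 * (3 * ε) * 2 ^ i := by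
          apply Finset.sum_le_sum
          intro i _
          have e : (cc (i + 1) - cc i) * (x * alr x i ^ 2) - (cc (i + 1) - cc i) =
            -((cc (i + 1) - cc i) * (1 - x * alr x i ^ 2)) := by ring
          have a0 := alr_nonneg hx0 i
          have a1 := alr_le_one hx0 hx1 i
          have al := alr_lower hε0.le hε1 i
          rw [← hxe] at al
          have hp1 : (1:ℝ) ≤ 2 ^ i := one_le_pow₀ (by norm_num)
          have a2 : alr x i ^ 2 ≤ 1 := by nlinarith
          have up : 0 ≤ 1 - x * alr x i ^ 2 := by nlinarith [sq_nonneg (alr x i)]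
          have lo : 1 - x * alr x i ^ 2 ≤ 3 * ε * 2 ^ i := by
            have : alr x i ^ 2 ≥ 1 - 2 * (2 ^ i * ε) := by nlinarith
            have h3 : x * alr x i ^ 2 ≥ alr x i ^ 2 - ε := by
              rw [hxe]; rw [hxe] at a2; nlinarith
            nlinarith
          rw [e, abs_neg, abs_mul, abs_of_nonneg up, mul_assoc]
          exact mul_le_mul (hb i) lo up (by norm_num)
      _ ≤ _ := by
          rw [← Finset.mul_sum]
          have hgs : ∑ i ∈ Finset.range r, (2:ℝ) ^ i = 2 ^ r - 1 := by
            have := geom_sum_mul (2:ℝ) r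
            linarith
          rw [hgs]
          have : ε * (2 ^ r - 1) ≤ 1 := by
            rw [hε]; field_simp; linarith
          nlinarith
  have h2 : |∑ i ∈ Finset.range m, (cc (r + i + 1) - cc (r + i)) * (x * alr x (r + i) ^ 2)| ≤
      3 / 64 * 2 := by
    calc _ ≤ ∑ i ∈ Finset.range m, |(cc (r + i + 1) - cc (r + i)) * (x * alr x (r + i) ^ 2)| :=
          Finset.abs_sum_le_sum_abs _ _
      _ ≤ ∑ i ∈ Finset.range m, 3 / 64 * (1 / (2:ℝ)) ^ i := by
          apply Finset.sum_le_sum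
          intro i _
          have a0 := alr_nonneg hx0 (r + i)
          have a1 := alr_le_one hx0 hx1 (r + i)
          have al := alr_upper hε0 hε1 (r + i)
          rw [← hxe] at al
          have e : 1 / (2 ^ (r + i) * ε) = (1 / (2:ℝ)) ^ i := by
            rw [hε, pow_add, div_pow, one_pow]; field_simp
          rw [e] at al
          have h3 : x * alr x (r + i) ^ 2 ≤ (1 / (2:ℝ)) ^ i := by
            have : alr x (r + i) ^ 2 ≤ alr x (r + i) := by nlinarith
            nlinarith [sq_nonneg (alr x (r + i))]
          have h4 : 0 ≤ x * alr x (r + i) ^ 2 := by positivity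
          rw [abs_mul, abs_of_nonneg h4]
          exact mul_le_mul (hb _) h3 h4 (by norm_num)
      _ ≤ _ := by
          rw [← Finset.mul_sum]
          have := sum_geometric_two_le m
          nlinarith
  calc _ ≤ _ := abs_add_le _ _
    _ ≤ 3 / 64 * 3 + 3 / 64 * 2 := add_le_add h1 h2
    _ ≤ _ := by norm_num

/-- summary of the first half -/
lemma exists_poly {p : ℝ} [Fact (1 ≤ ENNReal.ofReal p)] (hp : 1 < p) (S : ℕ) :
    ∃ φ : ℂ[X], ‖aeval (shiftOp (ENNReal.ofReal p)) φ‖ ≤ Kc p (Real.exp 2) ∧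
      ∀ n k : ℕ, n ≤ S → k ≤ S →
        1 / 2 ≤ (eval (nu (2 * k + 1) : ℂ) φ - eval (nu (2 * n) : ℂ) φ).re ∧
        (eval (nu (2 * k + 1) : ℂ) φ - eval (nu (2 * n) : ℂ) φ).im = 0 := by
  have c0 : cc 0 = 0 := by unfold cc; simp
  have cn : cc (rho (2 * S + 2)) = 0 := by
    rw [cc_rho]
    have : (-1 : ℝ) ^ (2 * S + 2) = 1 := Even.neg_one_pow ⟨S + 1, by ring⟩
    rw [this]; norm_num
  refine ⟨phi cc (rho (2 * S + 2)), ?_, ?_⟩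
  · apply shift_bound hp
    · unfold Kc
      refine le_trans ?_ (le_max_left _ _)
      have : 0 < (p - 1) / 2 := by linarith
      positivity
    · intro P _ f
      exact zmod_bound hp cc cc_nonneg cc_le_one _ c0 cn (Gam_cc _) f
  · intro n k hn hk
    have h1 := eval_close (2 * k + 1) (rho (2 * S + 2)) (rho_mono (by omega))
    have h2 := eval_close (2 * n) (rho (2 * S + 2)) (rho_mono (by omega))
    rw [cc_rho] at h1 h2
    rw [Odd.neg_one_pow ⟨k, rfl⟩] at h1
    rw [Even.neg_one_pow ⟨n, by ring⟩] at h2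
    rw [eval_phi] at h1 h2 ⊢
    rw [eval_phi]
    rw [← Complex.ofReal_sub, Complex.norm_real, Real.norm_eq_abs, abs_le] at h1 h2
    rw [← Complex.ofReal_sub]
    refine ⟨?_, Complex.ofReal_im _⟩
    rw [Complex.ofReal_re]
    linarith [h1.1, h2.2]

end RR

namespace RR

noncomputable def H (d : ℕ) : ℝ := ∑ i ∈ Finset.range d, 1 / ((i : ℝ) + 1)

noncomputable def kap (d : ℕ) : ℝ := 1 / (d * H d)

lemma H_succ (d : ℕ) : H (d + 1) = H d + 1 / ((d : ℝ) + 1) := by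
  unfold H; rw [Finset.sum_range_succ]

lemma H_nonneg (d : ℕ) : 0 ≤ H d := Finset.sum_nonneg fun _ _ => by positivity

lemma H_pos (d : ℕ) : 0 < H (d + 1) := by
  rw [H_succ]; have := H_nonneg d; positivity

lemma H_mono : Monotone H := by
  apply monotone_nat_of_le_succ
  intro n
  rw [H_succ]
  have : (0:ℝ) ≤ 1 / ((n : ℝ) + 1) := by positivity
  linarith

lemma H_tendsto : Filter.Tendsto H Filter.atTop Filter.atTop :=
  Real.tendsto_sum_range_one_div_nat_succ_atTop

lemma kap_nonneg (d : ℕ) : 0 ≤ kap d := by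
  unfold kap; have := H_nonneg d; positivity

lemma kap_anti (d : ℕ) : kap (d + 2) ≤ kap (d + 1) := by
  unfold kap
  have h1 := H_pos d
  have h2 := H_mono (show d + 1 ≤ d + 2 by omega)
  gcongr
  omega

lemma kap_diverge (R : ℕ) : ∃ D : ℕ, (R : ℝ) / 2 ≤ ∑ d ∈ Finset.range D, kap (d + 1) := by
  induction R with
  | zero => exact ⟨0, by simp⟩
  | succ R ih =>
    obtain ⟨a, ha⟩ := ih
    obtain ⟨b, hb, hab⟩ := ((H_tendsto.eventually_ge_atTop (2 * H a)).and
      (Filter.eventually_ge_atTop (a + 1))).exists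
    refine ⟨b, ?_⟩
    obtain ⟨m, rfl⟩ := Nat.exists_eq_add_of_le (show a ≤ b by omega)
    rw [Finset.sum_range_add]
    have hpos : 0 < H (a + m) := by
      have := H_pos (a + m - 1)
      rwa [show a + m - 1 + 1 = a + m by omega] at this
    have h1 : ∑ x ∈ Finset.range m, (H (a + x + 1) - H (a + x)) / H (a + m) ≤
        ∑ x ∈ Finset.range m, kap (a + x + 1) := by
      apply Finset.sum_le_sum
      intro x hx
      have hx := Finset.mem_range.1 hx
      have h3 := H_mono (show a + x + 1 ≤ a + m by omega)
      have h4 := H_pos (a + x)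
      have e : H (a + x + 1) - H (a + x) = 1 / ((a + x : ℕ) + 1 : ℝ) := by rw [H_succ]; ring
      rw [e, div_div]
      unfold kap
      push_cast at h3 h4 ⊢
      gcongr
    have h2 : ∑ x ∈ Finset.range m, (H (a + x + 1) - H (a + x)) = H (a + m) - H a :=
      Finset.sum_range_sub (fun x => H (a + x)) m
    rw [← Finset.sum_div, h2] at h1
    have h3 : (1:ℝ) / 2 ≤ (H (a + m) - H a) / H (a + m) := by
      rw [le_div_iff₀ hpos]; linarith
    push_cast
    linarith

lemma kap_odd_diverge (R : ℝ) : ∃ M : ℕ, 0 < M ∧ R ≤ ∑ e ∈ Finset.range M, kap (2 * e + 1) := by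
  obtain ⟨n, hn⟩ := exists_nat_ge (4 * R)
  obtain ⟨D, hD⟩ := kap_diverge n
  refine ⟨D + 1, by omega, ?_⟩
  have h1 : ∀ M : ℕ, ∑ d ∈ Finset.range (2 * M), kap (d + 1) ≤
      2 * ∑ e ∈ Finset.range M, kap (2 * e + 1) := by
    intro M
    induction M with
    | zero => simp
    | succ M ih =>
      rw [show 2 * (M + 1) = 2 * M + 1 + 1 by ring, Finset.sum_range_succ, Finset.sum_range_succ,
        Finset.sum_range_succ]
      have := kap_anti (2 * M)
      have e : 2 * M + 1 + 1 = 2 * M + 2 := rfl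
      rw [e]
      linarith
  have h2 : ∑ d ∈ Finset.range D, kap (d + 1) ≤ ∑ d ∈ Finset.range (2 * (D + 1)), kap (d + 1) := by
    apply Finset.sum_le_sum_of_subset_of_nonneg
    · intro x hx
      rw [Finset.mem_range] at hx ⊢
      omega
    · intro _ _ _; exact kap_nonneg _
  have := h1 (D + 1)
  linarith

lemma kap_double (U V : ℕ) :
    ∑ u ∈ Finset.range U, ∑ v ∈ Finset.range V, kap (u + v + 1) ^ 2 ≤ 4 := by
  have h1 : ∀ u V : ℕ, ∑ v ∈ Finset.range V, 1 / ((u : ℝ) + 1 + v) ^ 2 ≤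
      2 / ((u : ℝ) + 1) - 2 / ((u : ℝ) + 1 + V) := by
    intro u V
    induction V with
    | zero => simp
    | succ V ih =>
      rw [Finset.sum_range_succ]
      have : 1 / ((u : ℝ) + 1 + V) ^ 2 ≤ 2 / ((u : ℝ) + 1 + V) - 2 / ((u : ℝ) + 1 + (V + 1 : ℕ)) := by
        rw [div_sub_div _ _ (by positivity) (by positivity),
          div_le_div_iff₀ (by positivity) (by positivity)]
        push_cast
        have h1 : (0:ℝ) ≤ u := by positivity
        have h2 : (0:ℝ) ≤ V := by positivity
        have h3 : (1:ℝ) ≤ u + 1 + V := by linarith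
        set y := (u:ℝ) + 1 + V
        have e : (u:ℝ) + 1 + (V + 1) = y + 1 := by simp only [y]; ring
        rw [e]
        nlinarith
      linarith
  have h2 : ∀ u : ℕ, ∑ v ∈ Finset.range V, kap (u + v + 1) ^ 2 ≤
      2 * (1 / (((u : ℝ) + 1) * H (u + 1) ^ 2)) := by
    intro u
    have hu := H_pos u
    calc ∑ v ∈ Finset.range V, kap (u + v + 1) ^ 2
        ≤ ∑ v ∈ Finset.range V, 1 / H (u + 1) ^ 2 * (1 / ((u : ℝ) + 1 + v) ^ 2) := by
          apply Finset.sum_le_sum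
          intro v _
          have h3 := H_mono (show u + 1 ≤ u + v + 1 by omega)
          have h4 : kap (u + v + 1) ≤ 1 / (((u : ℝ) + 1 + v) * H (u + 1)) := by
            unfold kap
            push_cast
            have : (u : ℝ) + 1 + v = u + v + 1 := by ring
            rw [this]
            gcongr
          calc kap (u + v + 1) ^ 2 ≤ (1 / (((u : ℝ) + 1 + v) * H (u + 1))) ^ 2 := by
                have := kap_nonneg (u + v + 1)
                gcongr
            _ = _ := by field_simp
      _ = 1 / H (u + 1) ^ 2 * ∑ v ∈ Finset.range V, (1 / ((u : ℝ) + 1 + v) ^ 2) := by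
          rw [Finset.mul_sum]
      _ ≤ 1 / H (u + 1) ^ 2 * (2 / ((u : ℝ) + 1)) := by
          gcongr
          refine (h1 u V).trans ?_
          have : (0:ℝ) ≤ 2 / ((u : ℝ) + 1 + V) := by positivity
          linarith
      _ = _ := by field_simp
  have h3 : ∀ U : ℕ, ∑ u ∈ Finset.range (U + 1), (1 / (((u : ℝ) + 1) * H (u + 1) ^ 2)) ≤
      2 - 1 / H (U + 1) := by
    intro U
    induction U with
    | zero => simp [H]; norm_num
    | succ U ih =>
      rw [Finset.sum_range_succ]
      have hU := H_pos U
      have hU1 := H_pos (U + 1)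
      have e : H (U + 1 + 1) = H (U + 1) + 1 / (((U + 1 : ℕ) : ℝ) + 1) := H_succ (U + 1)
      have : 1 / ((((U + 1 : ℕ) : ℝ) + 1) * H (U + 1 + 1) ^ 2) ≤ 1 / H (U + 1) - 1 / H (U + 1 + 1) := by
        have e2 : 1 / H (U + 1) - 1 / H (U + 1 + 1) =
            (1 / (((U + 1 : ℕ) : ℝ) + 1)) / (H (U + 1) * H (U + 1 + 1)) := by
          rw [div_sub_div _ _ hU.ne' hU1.ne']
          congr 1
          linarith
        rw [e2, div_div]
        gcongr
        rw [sq]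
        gcongr
        exact H_mono (by omega)
      linarith
  calc _ ≤ ∑ u ∈ Finset.range U, 2 * (1 / (((u : ℝ) + 1) * H (u + 1) ^ 2)) :=
        Finset.sum_le_sum fun u _ => h2 u
    _ ≤ 4 := by
      rw [← Finset.mul_sum]
      cases U with
      | zero => simp
      | succ U =>
        have := h3 U
        have h4 : 0 < 1 / H (U + 1) := by have := H_pos U; positivity
        linarith

/-- off-diagonal matrix -/
noncomputable def mm (f : ℕ → ℂ) (s n : ℕ) : ℂ :=
  if n % 2 = 0 ∧ s % 2 = 1 then (f s - f n) * kap (s - n) else 0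

noncomputable def act (f a : ℕ → ℂ) (s : ℕ) : ℂ :=
  f s * a s + ∑ n ∈ Finset.range s, mm f s n * a n

lemma act_mul (f g a : ℕ → ℂ) : act f (act g a) = act (fun s => f s * g s) a := by
  funext s
  unfold act
  rw [mul_add, add_assoc, ← mul_assoc, Finset.mul_sum, ← Finset.sum_add_distrib]
  congr 1
  apply Finset.sum_congr rfl
  intro n _
  by_cases h : n % 2 = 0 ∧ s % 2 = 1
  · have hz : ∑ l ∈ Finset.range n, mm g n l * a l = 0 := by
      apply Finset.sum_eq_zero
      intro l _
      unfold mm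
      rw [if_neg (by omega), zero_mul]
    rw [hz]
    simp only [mm, if_pos h]
    ring
  · simp [mm, if_neg h]

lemma hs_bound (f : ℕ → ℝ) (hf : Monotone f) (h0 : ∀ s, 0 ≤ f s) (h1 : ∀ s, f s ≤ 1) (N : ℕ) :
    ∑ s ∈ Finset.range N, ∑ n ∈ Finset.range s, ‖mm (fun i => (f i : ℂ)) s n‖ ^ 2 ≤ 4 := by
  set δ : ℕ → ℝ := fun i => f (i + 1) - f i with hδ
  have hδ0 : ∀ i, 0 ≤ δ i := fun i => sub_nonneg.2 (hf (by omega))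
  set F : ℕ → ℕ → ℕ → ℝ := fun s n i => if n ≤ i ∧ i < s then δ i * kap (s - n) ^ 2 else 0 with hF
  have hF0 : ∀ s n i, 0 ≤ F s n i := by
    intro s n i
    simp only [hF]
    split_ifs
    · exact mul_nonneg (hδ0 i) (sq_nonneg _)
    · exact le_rfl
  have step1 : ∀ s ∈ Finset.range N, ∀ n ∈ Finset.range s,
      ‖mm (fun i => (f i : ℂ)) s n‖ ^ 2 ≤ ∑ i ∈ Finset.range N, F s n i := by
    intro s hs n hn
    have hs := Finset.mem_range.1 hs
    have hn := Finset.mem_range.1 hn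
    have e : ∑ i ∈ Finset.range N, F s n i = (f s - f n) * kap (s - n) ^ 2 := by
      simp only [hF]
      rw [← Finset.sum_filter]
      have : Finset.filter (fun i => n ≤ i ∧ i < s) (Finset.range N) = Finset.Ico n s := by
        ext i; simp only [Finset.mem_filter, Finset.mem_range, Finset.mem_Ico]; omega
      rw [this, ← Finset.sum_mul, hδ, Finset.sum_Ico_sub _ hn.le]
    rw [e]
    have hd : 0 ≤ f s - f n := sub_nonneg.2 (hf hn.le)
    have hd1 : f s - f n ≤ 1 := by linarith [h1 s, h0 n]
    unfold mm
    split_ifs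
    · rw [← Complex.ofReal_sub, ← Complex.ofReal_mul, Complex.norm_real, Real.norm_eq_abs, sq_abs,
        mul_pow]
      apply mul_le_mul_of_nonneg_right _ (sq_nonneg _)
      nlinarith
    · simp only [norm_zero]
      have := mul_nonneg hd (sq_nonneg (kap (s - n)))
      linarith
  have step2 : ∑ s ∈ Finset.range N, ∑ n ∈ Finset.range s, ‖mm (fun i => (f i : ℂ)) s n‖ ^ 2 ≤
      ∑ s ∈ Finset.range N, ∑ n ∈ Finset.range N, ∑ i ∈ Finset.range N, F s n i := by
    apply Finset.sum_le_sum
    intro s hs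
    refine (Finset.sum_le_sum (step1 s hs)).trans ?_
    apply Finset.sum_le_sum_of_subset_of_nonneg
    · intro n hn
      rw [Finset.mem_range] at *
      omega
    · intro n _ _
      exact Finset.sum_nonneg fun i _ => hF0 s n i
  have step3 : ∑ s ∈ Finset.range N, ∑ n ∈ Finset.range N, ∑ i ∈ Finset.range N, F s n i =
      ∑ i ∈ Finset.range N, ∑ s ∈ Finset.range N, ∑ n ∈ Finset.range N, F s n i := by
    rw [Finset.sum_comm' (t' := Finset.range N) (s' := fun _ => Finset.range N) (by simp)]
    rw [Finset.sum_comm]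
    have : ∀ n ∈ Finset.range N, ∑ s ∈ Finset.range N, ∑ i ∈ Finset.range N, F s n i =
        ∑ i ∈ Finset.range N, ∑ s ∈ Finset.range N, F s n i := fun n _ => Finset.sum_comm
    rw [Finset.sum_comm, Finset.sum_congr rfl this, Finset.sum_comm]
    exact Finset.sum_congr rfl fun i _ => Finset.sum_comm
  have step4 : ∀ i ∈ Finset.range N, ∑ s ∈ Finset.range N, ∑ n ∈ Finset.range N, F s n i ≤
      δ i * 4 := by
    intro i hi
    have hi := Finset.mem_range.1 hi
    have e : ∑ s ∈ Finset.range N, ∑ n ∈ Finset.range N, F s n i =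
        δ i * ∑ v ∈ Finset.range (N - (i + 1)), ∑ u ∈ Finset.range (i + 1), kap (u + v + 1) ^ 2 := by
      calc _ = ∑ s ∈ Finset.Ico (i + 1) N, ∑ n ∈ Finset.range (i + 1), δ i * kap (s - n) ^ 2 := by
            have e1 : Finset.Ico (i + 1) N = Finset.filter (fun s => i < s) (Finset.range N) := by
              ext s; simp only [Finset.mem_filter, Finset.mem_range, Finset.mem_Ico]; omega
            have e2 : Finset.range (i + 1) = Finset.filter (fun n => n ≤ i) (Finset.range N) := by
              ext s; simp only [Finset.mem_filter, Finset.mem_range]; omega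
            rw [e1, e2, Finset.sum_filter]
            apply Finset.sum_congr rfl
            intro s _
            split_ifs with h
            · rw [Finset.sum_filter]
              simp [hF, h]
            · simp [hF, h]
        _ = _ := by
            rw [Finset.sum_Ico_eq_sum_range, Finset.mul_sum]
            apply Finset.sum_congr rfl
            intro v _
            rw [← Finset.sum_range_reflect, Finset.mul_sum]
            apply Finset.sum_congr rfl
            intro u hu
            have hu := Finset.mem_range.1 hu
            congr 3
            omega
    rw [e, Finset.sum_comm]
    exact mul_le_mul_of_nonneg_left (kap_double _ _) (hδ0 i)
  refine step2.trans ?_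
  rw [step3]
  refine (Finset.sum_le_sum step4).trans ?_
  rw [← Finset.sum_mul, hδ, Finset.sum_range_sub]
  linarith [h0 0, h1 N]

end RR

namespace RR

/-- The Hilbert space `ℓ²(ℕ)`. -/
abbrev L2N : Type := lp (fun _ : ℕ => ℂ) 2

lemma l2_sum_le (a : L2N) (s : Finset ℕ) : ∑ i ∈ s, ‖a i‖ ^ 2 ≤ ‖a‖ ^ 2 := by
  have := lp.sum_rpow_le_norm_rpow (p := 2) (by norm_num) a s
  simpa using this

lemma l2_norm_le (a : L2N) {C : ℝ} (hC : 0 ≤ C) (h : ∀ N : ℕ, ∑ i ∈ Finset.range N, ‖a i‖ ^ 2 ≤ C ^ 2) :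
    ‖a‖ ≤ C := by
  apply lp.norm_le_of_forall_sum_le (p := 2) (by norm_num) hC
  intro s
  obtain ⟨N, hN⟩ := s.exists_nat_subset_range
  have := (Finset.sum_le_sum_of_subset_of_nonneg hN
    (f := fun i => ‖a i‖ ^ 2) (fun i _ _ => by positivity)).trans (h N)
  simpa using this

lemma l2_mem (a : ℕ → ℂ) (C : ℝ) (h : ∀ N : ℕ, ∑ i ∈ Finset.range N, ‖a i‖ ^ 2 ≤ C) :
    Memℓp a 2 := by
  apply memℓp_gen' (C := C)
  intro s
  obtain ⟨N, hN⟩ := s.exists_nat_subset_range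
  have := (Finset.sum_le_sum_of_subset_of_nonneg hN
    (f := fun i => ‖a i‖ ^ 2) (fun i _ _ => by positivity)).trans (h N)
  simpa using this

lemma act_bound (f : ℕ → ℝ) (hf : Monotone f) (h0 : ∀ s, 0 ≤ f s) (h1 : ∀ s, f s ≤ 1) (a : L2N)
    (N : ℕ) : ∑ s ∈ Finset.range N, ‖act (fun i => (f i : ℂ)) a s‖ ^ 2 ≤ (4 * ‖a‖) ^ 2 := by
  have key : ∀ s, ‖act (fun i => (f i : ℂ)) a s‖ ^ 2 ≤ 2 * ‖a s‖ ^ 2 +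
      2 * ((∑ n ∈ Finset.range s, ‖mm (fun i => (f i : ℂ)) s n‖ ^ 2) * ‖a‖ ^ 2) := by
    intro s
    unfold act
    have e1 : ‖(f s : ℂ) * a s‖ ≤ ‖a s‖ := by
      rw [norm_mul, Complex.norm_real, Real.norm_of_nonneg (h0 s)]
      exact mul_le_of_le_one_left (norm_nonneg _) (h1 s)
    have e2 : ‖∑ n ∈ Finset.range s, mm (fun i => (f i : ℂ)) s n * a n‖ ^ 2 ≤
        (∑ n ∈ Finset.range s, ‖mm (fun i => (f i : ℂ)) s n‖ ^ 2) * ‖a‖ ^ 2 := by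
      calc _ ≤ (∑ n ∈ Finset.range s, ‖mm (fun i => (f i : ℂ)) s n‖ * ‖a n‖) ^ 2 := by
            gcongr
            refine (norm_sum_le _ _).trans (le_of_eq ?_)
            simp
        _ ≤ _ := Finset.sum_mul_sq_le_sq_mul_sq _ _ _
        _ ≤ _ := by
            gcongr
            exact l2_sum_le a _
    have e3 := norm_add_le ((f s : ℂ) * a s) (∑ n ∈ Finset.range s, mm (fun i => (f i : ℂ)) s n * a n)
    have e4 : ‖(f s : ℂ) * a s‖ ^ 2 ≤ ‖a s‖ ^ 2 := by gcongr
    refine (pow_le_pow_left₀ (norm_nonneg _) e3 2).trans ?_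
    nlinarith [sq_nonneg (‖(f s : ℂ) * a s‖ - ‖∑ n ∈ Finset.range s, mm (fun i => (f i : ℂ)) s n * a n‖)]
  refine (Finset.sum_le_sum fun s _ => key s).trans ?_
  rw [Finset.sum_add_distrib, ← Finset.mul_sum, ← Finset.mul_sum, ← Finset.sum_mul]
  have h2 := l2_sum_le a (Finset.range N)
  have h3 := hs_bound f hf h0 h1 N
  nlinarith [sq_nonneg ‖a‖]

lemma act_add (f a b : ℕ → ℂ) : act f (a + b) = act f a + act f b := by
  funext s
  simp only [act, Pi.add_apply, mul_add, Finset.sum_add_distrib]; ring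

lemma act_smul (f : ℕ → ℂ) (c : ℂ) (a : ℕ → ℂ) : act f (c • a) = c • act f a := by
  funext s
  simp only [act, Pi.smul_apply, smul_eq_mul, mul_add, Finset.mul_sum]
  congr 1
  · ring
  · exact Finset.sum_congr rfl fun _ _ => by ring

lemma act_fadd (f g a : ℕ → ℂ) : act (fun s => f s + g s) a = act f a + act g a := by
  funext s
  simp only [act, Pi.add_apply, add_mul]
  have : ∀ n, mm (fun s => f s + g s) s n = mm f s n + mm g s n := by
    intro n; unfold mm; split_ifs
    · ring
    · simp
  simp only [this, add_mul, Finset.sum_add_distrib]; ring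

lemma act_const (c : ℂ) (a : ℕ → ℂ) : act (fun _ => c) a = c • a := by
  funext s
  simp [act, mm]

noncomputable def opL (f : ℕ → ℝ) (hf : Monotone f) (h0 : ∀ s, 0 ≤ f s) (h1 : ∀ s, f s ≤ 1) :
    L2N →L[ℂ] L2N :=
  LinearMap.mkContinuous
    { toFun := fun a => ⟨act (fun i => (f i : ℂ)) a, l2_mem _ _ (act_bound f hf h0 h1 a)⟩
      map_add' := by
        intro a b
        apply lp.ext
        exact act_add _ _ _
      map_smul' := by
        intro c a
        apply lp.ext
        exact act_smul _ _ _ } 4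
    (fun a => l2_norm_le _ (by positivity) (act_bound f hf h0 h1 a))

noncomputable def opA : L2N →L[ℂ] L2N := opL nu nu_mono nu_nonneg nu_le_one

lemma opA_apply (a : L2N) : (opA a : ℕ → ℂ) = act (fun i => (nu i : ℂ)) a := rfl

lemma aeval_opA (φ : ℂ[X]) (a : L2N) :
    (aeval opA φ a : ℕ → ℂ) = act (fun i => eval (nu i : ℂ) φ) a := by
  induction φ using Polynomial.induction_on' generalizing a with
  | add p q hp hq =>
    rw [map_add, ContinuousLinearMap.add_apply, lp.coeFn_add, hp, hq, ← act_fadd]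
    simp
  | monomial n c =>
    induction n generalizing a with
    | zero =>
      simp only [aeval_monomial, pow_zero, mul_one, eval_monomial]
      rw [act_const, Algebra.algebraMap_eq_smul_one]
      simp
    | succ n ih =>
      have : aeval opA (monomial (n+1) c) a = aeval opA (monomial n c) (opA a) := by
        simp only [aeval_monomial, pow_succ, ← mul_assoc]
        rfl
      rw [this, ih, opA_apply, act_mul]
      congr 1
      funext s
      simp only [eval_monomial, pow_succ, mul_assoc]

lemma aeval_opA_norm (φ : ℂ[X]) (f : ℕ → ℝ) (hf : Monotone f) (h0 : ∀ s, 0 ≤ f s)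
    (h1 : ∀ s, f s ≤ 1) (h : ∀ s, eval (nu s : ℂ) φ = f s) : ‖aeval opA φ‖ ≤ 4 := by
  refine ContinuousLinearMap.opNorm_le_bound _ (by norm_num) fun a => ?_
  refine l2_norm_le _ (by positivity) fun N => ?_
  rw [aeval_opA]
  simp only [h]
  exact act_bound f hf h0 h1 a N

lemma opA_pow (n : ℕ) : ‖opA ^ n‖ ≤ 4 := by
  have := aeval_opA_norm (X ^ n) (fun s => nu s ^ n)
    (fun a b h => pow_le_pow_left₀ (nu_nonneg a) (nu_mono h) n)
    (fun s => pow_nonneg (nu_nonneg s) n) (fun s => pow_le_one₀ (nu_nonneg s) (nu_le_one s))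
    (fun s => by simp)
  simpa using this

lemma gmono (n : ℕ) {x y : ℝ} (hx : 0 ≤ x) (hxy : x ≤ y) (hy : y ≤ 1) :
    (n + 1) * x ^ n - n * x ^ (n + 1) ≤ (n + 1) * y ^ n - n * y ^ (n + 1) := by
  induction n with
  | zero => simp
  | succ n ih =>
    -- g_{n+1}(z) - g_n(z) = -(n+1) z^n (1-z)^2 ; use the derivative instead
    have hm : MonotoneOn (fun z : ℝ => ((n + 1 : ℕ) + 1 : ℝ) * z ^ (n + 1) - ((n + 1 : ℕ) : ℝ) * z ^ (n + 1 + 1))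
        (Set.Icc 0 1) := by
      apply monotoneOn_of_deriv_nonneg (convex_Icc 0 1)
      · fun_prop
      · fun_prop
      · intro z hz
        rw [interior_Icc] at hz
        have hd : HasDerivAt (fun z : ℝ => ((n + 1 : ℕ) + 1 : ℝ) * z ^ (n + 1) - ((n + 1 : ℕ) : ℝ) * z ^ (n + 1 + 1))
            (((n + 1 : ℕ) + 1 : ℝ) * (((n + 1 : ℕ) : ℝ) * z ^ n) -
              ((n + 1 : ℕ) : ℝ) * (((n + 1 + 1 : ℕ) : ℝ) * z ^ (n + 1))) z :=
          ((hasDerivAt_pow (n+1) z).const_mul _).sub ((hasDerivAt_pow (n+1+1) z).const_mul _)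
        rw [hd.deriv]
        have h1 : 0 ≤ z ^ n := pow_nonneg hz.1.le _
        have h2 : 0 ≤ z ^ n * (1 - z) := mul_nonneg h1 (by linarith [hz.2])
        push_cast
        have : 0 ≤ ((n:ℝ) + 1 + 1) * ((n:ℝ)+1) * (z ^ n * (1 - z)) := by positivity
        refine this.trans (le_of_eq ?_)
        ring
    exact hm ⟨hx, hxy.trans hy⟩ ⟨hx.trans hxy, hy⟩ hxy

lemma opA_diff (n : ℕ) : ‖((n + 1 : ℕ) : ℂ) • (opA ^ (n + 1) - opA ^ n)‖ ≤ 8 := by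
  have h := aeval_opA_norm (C ((n : ℂ) + 1) * X ^ n - C (n : ℂ) * X ^ (n + 1))
    (fun s => (n + 1) * nu s ^ n - n * nu s ^ (n + 1))
    (fun a b h => gmono n (nu_nonneg a) (nu_mono h) (nu_le_one b))
    (fun s => by
      have h1 : 0 ≤ nu s ^ n := pow_nonneg (nu_nonneg s) n
      have h2 := nu_le_one s
      have h3 : 0 ≤ nu s ^ n * (1 - nu s) := mul_nonneg h1 (by linarith)
      have : 0 ≤ (n:ℝ) * (nu s ^ n * (1 - nu s)) := by positivity
      rw [pow_succ]; nlinarith)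
    (fun s => by
      have := gmono n (nu_nonneg s) (nu_le_one s) le_rfl
      simpa using this)
    (fun s => by simp)
  have e : ((n + 1 : ℕ) : ℂ) • (opA ^ (n + 1) - opA ^ n) = opA ^ (n+1) -
      aeval opA (C ((n : ℂ) + 1) * X ^ n - C (n : ℂ) * X ^ (n + 1)) := by
    simp only [map_sub, map_mul, aeval_C, map_pow, aeval_X, Algebra.algebraMap_eq_smul_one, smul_mul_assoc, one_mul]
    push_cast
    module
  rw [e]
  refine (norm_sub_le _ _).trans ?_
  linarith [opA_pow (n+1)]

end RR

namespace RR

lemma sum_even (g : ℕ → ℂ) (hg : ∀ n, n % 2 = 1 → g n = 0) (k : ℕ) :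
    ∑ n ∈ Finset.range (2 * k + 1), g n = ∑ j ∈ Finset.range (k + 1), g (2 * j) := by
  induction k with
  | zero => simp
  | succ k ih =>
    rw [show 2 * (k + 1) + 1 = 2 * k + 1 + 1 + 1 by ring, Finset.sum_range_succ, Finset.sum_range_succ, ih,
      hg (2*k+1) (by omega), Finset.sum_range_succ _ (k+1)]
    simp [show 2 * k + 1 + 1 = 2 * (k + 1) by ring]

noncomputable def tv (M : ℕ) (n : ℕ) : ℂ := if n % 2 = 0 ∧ n < 4 * M then 1 else 0

lemma tv_sum (M N : ℕ) : ∑ i ∈ Finset.range N, ‖tv M i‖ ^ 2 ≤ 2 * M := by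
  have h2 : ∀ K, ∑ i ∈ Finset.range (2 * K), ‖tv M i‖ ^ 2 ≤ (min K (2 * M) : ℕ) := by
    intro K
    induction K with
    | zero => simp
    | succ K ih =>
      rw [show 2 * (K + 1) = 2 * K + 1 + 1 by ring, Finset.sum_range_succ, Finset.sum_range_succ]
      have e1 : ‖tv M (2 * K + 1)‖ ^ 2 = 0 := by
        simp [tv, show (2 * K + 1) % 2 = 1 by omega]
      rw [e1]
      by_cases hK : K < 2 * M
      · have : ‖tv M (2 * K)‖ ^ 2 ≤ 1 := by
          unfold tv; split_ifs <;> simp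
        rw [min_eq_left (by omega)]
        rw [min_eq_left (by omega)] at ih
        push_cast; linarith
      · have : ‖tv M (2 * K)‖ ^ 2 = 0 := by
          unfold tv; rw [if_neg (by omega)]; simp
        rw [min_eq_right (by omega)]
        rw [min_eq_right (by omega)] at ih
        push_cast at *; linarith
  calc _ ≤ ∑ i ∈ Finset.range (2 * N), ‖tv M i‖ ^ 2 :=
        Finset.sum_le_sum_of_subset_of_nonneg (by intro x; simp; omega) (fun i _ _ => by positivity)
    _ ≤ _ := h2 N
    _ ≤ _ := by exact_mod_cast min_le_right _ _

lemma opA_lower (φ : ℂ[X]) (M : ℕ) (hM : 0 < M) (R : ℝ) (hR : 0 ≤ R)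
    (hk : R ≤ ∑ e ∈ Finset.range M, kap (2 * e + 1))
    (hφ : ∀ n k : ℕ, n ≤ 2 * M → k ≤ 2 * M →
      1 / 2 ≤ (eval (nu (2*k+1) : ℂ) φ - eval (nu (2*n) : ℂ) φ).re) :
    R / 3 ≤ ‖aeval opA φ‖ := by
  set a : L2N := ⟨tv M, l2_mem _ _ (tv_sum M)⟩ with ha
  have hac : (a : ℕ → ℂ) = tv M := rfl
  have han : ‖a‖ ^ 2 ≤ 2 * M := by
    have h1 : ‖a‖ ≤ Real.sqrt (2 * M) := by
      apply l2_norm_le _ (Real.sqrt_nonneg _)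
      intro N
      rw [Real.sq_sqrt (by positivity), hac]
      exact tv_sum M N
    have := pow_le_pow_left₀ (norm_nonneg _) h1 2
    rwa [Real.sq_sqrt (by positivity)] at this
  have hlow : ∀ k, M ≤ k → k < 2 * M → R / 2 ≤ ‖aeval opA φ a (2 * k + 1)‖ := by
    intro k h1 h2
    rw [aeval_opA, hac]
    unfold act
    have e0 : tv M (2 * k + 1) = 0 := by simp [tv, show (2 * k + 1) % 2 = 1 by omega]
    rw [e0, mul_zero, zero_add, sum_even]
    swap
    · intro n hn; simp [tv, hn]
    refine le_trans ?_ (Complex.re_le_norm _)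
    rw [Complex.re_sum]
    have e1 : ∀ j ∈ Finset.range (k + 1), 1 / 2 * kap (2 * (k - j) + 1) ≤
        (mm (fun i => eval (nu i : ℂ) φ) (2 * k + 1) (2 * j) * tv M (2 * j)).re := by
      intro j hj
      have hj := Finset.mem_range.1 hj
      have : tv M (2 * j) = 1 := by
        unfold tv; rw [if_pos (by omega)]
      rw [this, mul_one]
      unfold mm
      rw [if_pos (by omega), Complex.re_mul_ofReal, show 2 * k + 1 - 2 * j = 2 * (k - j) + 1 by omega]
      exact mul_le_mul_of_nonneg_right (hφ j k (by omega) (by omega)) (kap_nonneg _)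
    refine le_trans ?_ (Finset.sum_le_sum e1)
    rw [← Finset.mul_sum]
    have e2 := Finset.sum_range_reflect (fun e => kap (2 * e + 1)) (k + 1)
    simp only [Nat.add_sub_cancel] at e2
    rw [e2]
    have e3 : ∑ e ∈ Finset.range M, kap (2 * e + 1) ≤ ∑ e ∈ Finset.range (k+1), kap (2 * e + 1) :=
      Finset.sum_le_sum_of_subset_of_nonneg (by intro x; simp; omega) (fun i _ _ => kap_nonneg _)
    linarith
  have hsum : M * (R / 2) ^ 2 ≤ ‖aeval opA φ a‖ ^ 2 := by
    have := l2_sum_le (aeval opA φ a) ((Finset.Ico M (2 * M)).image (fun k => 2 * k + 1))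
    refine le_trans ?_ this
    rw [Finset.sum_image (by intro x _ y _ h; simpa using h)]
    have h4 : ∑ k ∈ Finset.Ico M (2 * M), (R/2)^2 ≤
       ∑ k ∈ Finset.Ico M (2 * M), ‖aeval opA φ a (2 * k + 1)‖ ^ 2 := by
      apply Finset.sum_le_sum
      intro k hk
      have hk := Finset.mem_Ico.1 hk
      exact pow_le_pow_left₀ (by positivity) (hlow k hk.1 hk.2) 2
    refine le_trans (le_of_eq ?_) h4
    simp [show 2 * M - M = M by omega]
  have hle : ‖aeval opA φ a‖ ^ 2 ≤ ‖aeval opA φ‖ ^ 2 * (2 * M) := by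
    calc _ ≤ (‖aeval opA φ‖ * ‖a‖) ^ 2 := by
          gcongr; exact ContinuousLinearMap.le_opNorm _ _
      _ ≤ _ := by rw [mul_pow]; gcongr
  have hMr : (0:ℝ) < M := by exact_mod_cast hM
  have : (R / 2) ^ 2 ≤ ‖aeval opA φ‖ ^ 2 * 2 := by
    by_contra hc
    push Not at hc
    nlinarith
  apply le_of_sq_le_sq _ (norm_nonneg _)
  nlinarith

/-- The polynomials separating. -/
lemma opA_unbdd {p : ℝ} [Fact (1 ≤ ENNReal.ofReal p)] (hp : 1 < p) (R : ℝ) :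
    ∃ φ : ℂ[X], ‖aeval (shiftOp (ENNReal.ofReal p)) φ‖ ≤ Kc p (Real.exp 2) ∧ R ≤ ‖aeval opA φ‖ := by
  obtain ⟨M, hM, hk⟩ := kap_odd_diverge (3 * |R|)
  obtain ⟨φ, h1, h2⟩ := exists_poly hp (2 * M)
  refine ⟨φ, h1, ?_⟩
  have := opA_lower φ M hM (3 * |R|) (by positivity) hk (fun n k hn hk => (h2 n k hn hk).1)
  linarith [le_abs_self R]

end RR

namespace RR

lemma two_point (A D y : ℝ) (hA : 0 ≤ A) (hy : 0 ≤ y) (hD : D ^ 2 ≤ 4 * y * A) (hDA : |D| ≤ A) (r : ℕ) :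
    1 / 2 * ((A + D) ^ r + (A - D) ^ r) ≤ (A + 4 * r * y) ^ r := by
  have h1 : ∀ r : ℕ, ∃ P q : ℝ, P + D * q = (A + D) ^ r ∧ P - D * q = (A - D) ^ r ∧ 0 ≤ P ∧ 0 ≤ q ∧
      A * q ≤ r * P ∧ ∀ s : ℕ, r ≤ s → P ≤ (A + 4 * s * y) ^ r := by
    intro r
    induction r with
    | zero => exact ⟨1, 0, by simp, by simp, by simp, by simp, by simp, by simp⟩
    | succ r ih =>
      obtain ⟨P, q, e1, e2, hP, hq, hPq, hs⟩ := ih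
      refine ⟨A * P + D ^ 2 * q, P + A * q, ?_, ?_, by positivity, by positivity, ?_, ?_⟩
      · rw [pow_succ (A + D), ← e1]; ring
      · rw [pow_succ (A - D), ← e2]; ring
      · push_cast
        have : 0 ≤ ((r:ℝ) + 1) * (D ^ 2 * q) := by positivity
        nlinarith [mul_le_mul_of_nonneg_left hPq hA]
      · intro s hrs
        have h2 := hs s (by omega)
        have h3 : (r : ℝ) ≤ s := by exact_mod_cast (show r ≤ s by omega)
        calc A * P + D ^ 2 * q ≤ A * P + 4 * y * A * q := by gcongr
          _ = A * P + 4 * y * (A * q) := by ring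
          _ ≤ A * P + 4 * y * (r * P) := by gcongr
          _ ≤ A * P + 4 * y * (s * P) := by gcongr
          _ = P * (A + 4 * s * y) := by ring
          _ ≤ (A + 4 * s * y) ^ r * (A + 4 * s * y) := by gcongr
          _ = _ := by rw [pow_succ]
  obtain ⟨P, q, e1, e2, -, -, -, hs⟩ := h1 r
  rw [← e1, ← e2]
  have := hs r le_rfl
  linarith

/-- The lacunary characters. -/
noncomputable def u (n : ℕ) (x : ℝ) : ℂ := Complex.exp (2 * Real.pi * Complex.I * (2 ^ n * x))

lemma u_cont (n : ℕ) : Continuous (u n) := by unfold u; fun_prop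

lemma u_norm (n : ℕ) (x : ℝ) : ‖u n x‖ = 1 := by
  unfold u
  have : (2 * Real.pi * Complex.I * (2 ^ n * x) : ℂ) = ((2 * Real.pi * (2 ^ n * x) : ℝ) : ℂ) * Complex.I := by
    push_cast; ring
  rw [this, Complex.norm_exp_ofReal_mul_I]

lemma u_shift (m n : ℕ) (h : m < n) (x : ℝ) : u n (x + 1 / 2 ^ (m + 1)) = u n x := by
  unfold u
  obtain ⟨d, rfl⟩ := Nat.exists_eq_add_of_lt h
  rw [Complex.exp_eq_exp_iff_exists_int]
  refine ⟨2 ^ d, ?_⟩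
  push_cast
  have : (2:ℂ) ^ (m + 1) ≠ 0 := pow_ne_zero _ two_ne_zero
  rw [show m + d + 1 = (m + 1) + d by ring, pow_add _ (m+1) d]
  field_simp

lemma u_half (m : ℕ) (x : ℝ) : u m (x + 1 / 2 ^ (m + 1)) = - u m x := by
  unfold u
  have : (2 * Real.pi * Complex.I * (2 ^ m * ((x + 1 / 2 ^ (m + 1) : ℝ) : ℂ)) : ℂ) =
    2 * Real.pi * Complex.I * (2 ^ m * x) + Real.pi * Complex.I := by
    push_cast
    rw [pow_succ]
    field_simp
  rw [this, Complex.exp_add, Complex.exp_pi_mul_I]; ring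

lemma u_per (n : ℕ) (x : ℝ) : u n (x + 1) = u n x := by
  unfold u
  rw [Complex.exp_eq_exp_iff_exists_int]
  refine ⟨2 ^ n, ?_⟩
  push_cast
  ring

lemma int_shift (g : ℝ → ℝ) (hg : Function.Periodic g 1) (h : ℝ) :
    ∫ x in (0:ℝ)..1, g (x + h) = ∫ x in (0:ℝ)..1, g x := by
  rw [intervalIntegral.integral_comp_add_right]
  have := hg.intervalIntegral_add_eq (0 + h) 0
  simpa [add_comm] using this

variable {E : Type*} [NormedAddCommGroup E] [InnerProductSpace ℂ E]

lemma khin_step (r : ℕ) (t : ℝ) (ht : 0 ≤ t) (W V : E) :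
    1 / 2 * ((‖W + V‖ ^ 2 + t) ^ r + (‖W - V‖ ^ 2 + t) ^ r) ≤
      (‖W‖ ^ 2 + ((4 * r + 1) * ‖V‖ ^ 2 + t)) ^ r := by
  have e1 := norm_add_sq (𝕜 := ℂ) W V
  have e2 := norm_sub_sq (𝕜 := ℂ) W V
  set d : ℝ := RCLike.re (inner ℂ W V) with hd
  have hd1 : |d| ≤ ‖W‖ * ‖V‖ := (RCLike.abs_re_le_norm _).trans (norm_inner_le_norm _ _)
  have hd2 : d ^ 2 ≤ ‖W‖ ^ 2 * ‖V‖ ^ 2 := by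
    rw [← sq_abs, ← mul_pow]; exact pow_le_pow_left₀ (abs_nonneg _) hd1 2
  have h := two_point (‖W‖ ^ 2 + ‖V‖ ^ 2 + t) (2 * d) (‖V‖ ^ 2) (by positivity) (by positivity)
    (by nlinarith [mul_nonneg (sq_nonneg ‖V‖) (sq_nonneg ‖V‖), mul_nonneg (sq_nonneg ‖V‖) ht])
    (by rw [abs_mul, abs_two]; nlinarith [sq_nonneg (‖W‖ - ‖V‖)]) r
  rw [e1, e2]
  calc _ = 1 / 2 * ((‖W‖ ^ 2 + ‖V‖ ^ 2 + t + 2 * d) ^ r + (‖W‖ ^ 2 + ‖V‖ ^ 2 + t - 2 * d) ^ r) := by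
        congr 2 <;> ring
    _ ≤ _ := h
    _ = _ := by congr 1; ring

lemma khin (r : ℕ) (N : ℕ) : ∀ (m : ℕ) (Y : ℕ → E) (t : ℝ), 0 ≤ t →
    ∫ x in (0:ℝ)..1, (‖∑ n ∈ Finset.range N, u (m + n) x • Y n‖ ^ 2 + t) ^ r ≤
      ((4 * r + 1) * ∑ n ∈ Finset.range N, ‖Y n‖ ^ 2 + t) ^ r := by
  induction N with
  | zero => intro m Y t ht; simp
  | succ N ih =>
    intro m Y t ht
    set W : ℝ → E := fun x => ∑ n ∈ Finset.range N, u (m + 1 + n) x • Y (n + 1) with hW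
    set V : ℝ → E := fun x => u m x • Y 0 with hV
    have hWc : Continuous W := by
      have := u_cont
      fun_prop
    have hVc : Continuous V := by
      have := u_cont
      fun_prop
    have hsum : ∀ x, ∑ n ∈ Finset.range (N + 1), u (m + n) x • Y n = W x + V x := by
      intro x
      rw [Finset.sum_range_succ']
      simp only [hW, hV, add_zero]
      congr 1
      apply Finset.sum_congr rfl
      intro n _
      rw [show m + (n + 1) = m + 1 + n by ring]
    simp only [hsum]
    set g : ℝ → ℝ := fun x => (‖W x + V x‖ ^ 2 + t) ^ r with hg
    have hgc : Continuous g := by fun_prop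
    have hgp : Function.Periodic g 1 := by
      intro x
      simp only [hg, hW, hV, u_per]
    set h : ℝ := 1 / 2 ^ (m + 1) with hh
    have hgh : ∀ x, g (x + h) = (‖W x - V x‖ ^ 2 + t) ^ r := by
      intro x
      have e1 : W (x + h) = W x := by
        simp only [hW]
        apply Finset.sum_congr rfl
        intro n _
        rw [u_shift m (m + 1 + n) (by omega)]
      have e2 : V (x + h) = - V x := by
        simp only [hV]
        rw [u_half, neg_smul]
      simp only [hg]
      rw [e1, e2, sub_eq_add_neg]
    have e1 : ∫ x in (0:ℝ)..1, g x = ∫ x in (0:ℝ)..1, 1 / 2 * (g x + g (x + h)) := by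
      rw [intervalIntegral.integral_const_mul, intervalIntegral.integral_add
        (hgc.intervalIntegrable _ _) (Continuous.intervalIntegrable (by fun_prop) _ _), int_shift g hgp]
      ring
    change ∫ x in (0:ℝ)..1, g x ≤ _
    rw [e1]
    have e2 : ∫ x in (0:ℝ)..1, 1 / 2 * (g x + g (x + h)) ≤
        ∫ x in (0:ℝ)..1, (‖W x‖ ^ 2 + ((4 * r + 1) * ‖Y 0‖ ^ 2 + t)) ^ r := by
      apply intervalIntegral.integral_mono_on (by norm_num)
      · exact Continuous.intervalIntegrable (by fun_prop) _ _
      · exact Continuous.intervalIntegrable (by fun_prop) _ _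
      · intro x _
        rw [hgh]
        have := khin_step r t ht (W x) (V x)
        have hv : ‖V x‖ = ‖Y 0‖ := by simp only [hV, norm_smul, u_norm, one_mul]
        rw [hv] at this
        exact this
    refine e2.trans ((ih (m + 1) (fun n => Y (n + 1)) _ (by positivity)).trans (le_of_eq ?_))
    rw [Finset.sum_range_succ' (fun n => ‖Y n‖ ^ 2)]
    congr 1
    ring

end RR

namespace RR

variable {E : Type*} [NormedAddCommGroup E] [InnerProductSpace ℂ E]

/-- Lacunary sums on the unit interval. -/
noncomputable def FS (N : ℕ) (Y : ℕ → E) (x : I) : E := ∑ n ∈ Finset.range N, u n (x : ℝ) • Y n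

lemma FS_cont (N : ℕ) (Y : ℕ → E) : Continuous (FS N Y) := by
  unfold FS
  have := u_cont
  fun_prop

lemma FS_memLp (N : ℕ) (Y : ℕ → E) (P : ℝ≥0∞) : MemLp (FS N Y) P (volume : Measure I) := by
  apply MemLp.of_bound (FS_cont N Y).aestronglyMeasurable (∑ n ∈ Finset.range N, ‖Y n‖)
  refine Filter.Eventually.of_forall fun x => ?_
  unfold FS
  refine (norm_sum_le _ _).trans (le_of_eq ?_)
  simp [norm_smul, u_norm]

lemma int_I {G : Type*} [NormedAddCommGroup G] [NormedSpace ℝ G] (f : ℝ → G) :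
    ∫ x : I, f x = ∫ x in (0:ℝ)..1, f x := by
  rw [intervalIntegral.integral_of_le zero_le_one, ← integral_Icc_eq_integral_Ioc]
  exact integral_subtype_comap measurableSet_Icc f

noncomputable def kr (P : ℝ≥0∞) : ℕ := ⌈P.toReal⌉₊ + 1

/-- Khinchine constant. -/
noncomputable def kc (P : ℝ≥0∞) : ℝ := Real.sqrt (4 * kr P + 1)

lemma kc_nonneg (P : ℝ≥0∞) : 0 ≤ kc P := Real.sqrt_nonneg _

lemma khinI (P : ℝ≥0∞) (hP : P ≠ ∞) (N : ℕ) (Y : ℕ → E) :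
    eLpNorm (FS N Y) P (volume : Measure I) ≤
      ENNReal.ofReal (kc P * Real.sqrt (∑ n ∈ Finset.range N, ‖Y n‖ ^ 2)) := by
  set r := kr P with hr
  have hPr : P ≤ ENNReal.ofReal (2 * r : ℝ) := by
    rw [← ENNReal.ofReal_toReal hP]
    apply ENNReal.ofReal_le_ofReal
    have := Nat.le_ceil P.toReal
    have h2 : (r : ℝ) = ⌈P.toReal⌉₊ + 1 := by rw [hr, kr]; push_cast; rfl
    have h3 : (0:ℝ) ≤ (⌈P.toReal⌉₊ : ℝ) := by positivity
    linarith
  have hr1 : (0:ℝ) < r := by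
    have : 0 < r := by rw [hr, kr]; omega
    exact_mod_cast this
  refine (eLpNorm_le_eLpNorm_of_exponent_le hPr (FS_cont N Y).aestronglyMeasurable).trans ?_
  rw [MemLp.eLpNorm_eq_integral_rpow_norm (by rw [Ne, ENNReal.ofReal_eq_zero]; linarith) ENNReal.ofReal_ne_top (FS_memLp N Y _)]
  apply ENNReal.ofReal_le_ofReal
  rw [ENNReal.toReal_ofReal (by positivity)]
  have hk := khin (E := E) r N 0 Y 0 le_rfl
  have e : ∫ a : I, ‖FS N Y a‖ ^ (2 * r : ℝ) ≤ ((4 * r + 1) * ∑ n ∈ Finset.range N, ‖Y n‖ ^ 2) ^ r := by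
    rw [← int_I (fun x => (‖∑ n ∈ Finset.range N, u (0 + n) x • Y n‖ ^ 2 + 0) ^ r)] at hk
    simp only [add_zero, zero_add] at hk
    refine le_trans (le_of_eq ?_) hk
    congr 1
    funext x
    rw [show (2 * r : ℝ) = ((2 * r : ℕ) : ℝ) by push_cast; rfl, Real.rpow_natCast, pow_mul]
    rfl
  set sg := ∑ n ∈ Finset.range N, ‖Y n‖ ^ 2 with hsg
  have hsg0 : 0 ≤ sg := Finset.sum_nonneg fun _ _ => by positivity
  calc _ ≤ (((4 * r + 1) * sg) ^ r) ^ ((2 * r : ℝ)⁻¹) :=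
        Real.rpow_le_rpow (integral_nonneg fun x => by positivity) e (by positivity)
    _ = kc P * Real.sqrt sg := by
        rw [kc, ← hr, ← Real.sqrt_mul (by positivity), Real.sqrt_eq_rpow, ← Real.rpow_natCast,
          ← Real.rpow_mul (by positivity)]
        congr 1
        field_simp

section Q
variable [CompleteSpace E]

/-- Lacunary Fourier coefficients. -/
noncomputable def qc (X : I → E) (n : ℕ) : E := ∫ x : I, (starRingEnd ℂ (u n (x : ℝ))) • X x

lemma qc_integrable {X : I → E} (hX : Integrable X) (n : ℕ) :
    Integrable (fun x : I => (starRingEnd ℂ (u n (x : ℝ))) • X x) := by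
  refine Integrable.bdd_smul hX 1 ?_ ?_
  · have := u_cont
    exact Continuous.aestronglyMeasurable (by fun_prop)
  · exact Filter.Eventually.of_forall fun x => by simp [u_norm]

lemma qc_bound {p : ℝ} (hp : 1 < p) (X : I → E) (hX : MemLp X (ENNReal.ofReal p)) (N : ℕ) :
    ∑ n ∈ Finset.range N, ‖qc X n‖ ^ 2 ≤
      (kc (ENNReal.ofReal p.conjExponent) * (eLpNorm X (ENNReal.ofReal p) volume).toReal) ^ 2 := by
  have hX1 : Integrable X := hX.integrable (by
    rw [← ENNReal.ofReal_one]; exact ENNReal.ofReal_le_ofReal hp.le)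
  set s := ∑ n ∈ Finset.range N, ‖qc X n‖ ^ 2 with hs
  set P' := ENNReal.ofReal p.conjExponent with hP'
  set F := FS N (qc X) with hF
  have hs0 : 0 ≤ s := Finset.sum_nonneg fun _ _ => by positivity
  have e1 : (s : ℂ) = ∫ x : I, inner ℂ (F x) (X x) := by
    have : ∀ x, inner ℂ (F x) (X x) =
        ∑ n ∈ Finset.range N, inner ℂ (qc X n) ((starRingEnd ℂ (u n (x : ℝ))) • X x) := by
      intro x
      simp only [hF, FS, sum_inner, inner_smul_left, inner_smul_right]
    simp only [this]
    rw [integral_finsetSum]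
    · rw [hs]
      push_cast
      apply Finset.sum_congr rfl
      intro n _
      rw [integral_inner (qc_integrable hX1 n)]
      rw [← qc, inner_self_eq_norm_sq_to_K]
      rfl
    · intro n _
      exact (qc_integrable hX1 n).const_inner _
  have : (ENNReal.ofReal p.conjExponent).HolderTriple (ENNReal.ofReal p) 1 :=
    (Real.HolderConjugate.conjExponent hp).symm.ennrealOfReal
  have e2 : ENNReal.ofReal s ≤ ENNReal.ofReal (kc P' * Real.sqrt s) * eLpNorm X (ENNReal.ofReal p) volume := by
    have h1 : ENNReal.ofReal s = ‖(s : ℂ)‖ₑ := by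
      rw [← ofReal_norm, Complex.norm_real, Real.norm_of_nonneg hs0]
    rw [h1, e1]
    refine (enorm_integral_le_lintegral_enorm _).trans ?_
    rw [← eLpNorm_one_eq_lintegral_enorm]
    have := eLpNorm_le_eLpNorm_mul_eLpNorm_of_nnnorm (p := P') (q := ENNReal.ofReal p) (r := 1)
      (FS_cont N (qc X)).aestronglyMeasurable hX.aestronglyMeasurable
      (fun a b => inner ℂ a b) 1 (Filter.Eventually.of_forall fun x => by
        rw [one_mul]; exact nnnorm_inner_le_nnnorm _ _)
    refine this.trans ?_
    rw [ENNReal.coe_one, one_mul]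
    gcongr
    exact khinI P' (by simp [hP']) N (qc X)
  have hfin : eLpNorm X (ENNReal.ofReal p) volume ≠ ∞ := hX.eLpNorm_ne_top
  set B := (eLpNorm X (ENNReal.ofReal p) volume).toReal with hB
  have e3 : s ≤ kc P' * Real.sqrt s * B := by
    rw [← ENNReal.ofReal_toReal hfin, ← ENNReal.ofReal_mul (by have := kc_nonneg P'; positivity)] at e2
    exact (ENNReal.ofReal_le_ofReal_iff (by have := kc_nonneg P'; positivity)).1 e2
  have h4 : Real.sqrt s ^ 2 = s := Real.sq_sqrt hs0
  have h5 : Real.sqrt s ≤ kc P' * B := by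
    rcases (Real.sqrt_nonneg s).eq_or_lt with h | h
    · rw [← h]; have := kc_nonneg P'; positivity
    · by_contra hc
      push Not at hc
      nlinarith
  rw [← h4]
  exact pow_le_pow_left₀ (Real.sqrt_nonneg _) h5 2

end Q

lemma u_orth (m n : ℕ) : ∫ x : I, (starRingEnd ℂ (u n (x : ℝ))) * u m (x : ℝ) = if m = n then 1 else 0 := by
  rw [int_I (fun x => (starRingEnd ℂ (u n x)) * u m x)]
  split_ifs with h
  · subst h
    have : ∀ x, (starRingEnd ℂ (u m x)) * u m x = 1 := by
      intro x
      rw [mul_comm, Complex.mul_conj, Complex.normSq_eq_norm_sq, u_norm]; simp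
    simp [this]
  · set c : ℂ := 2 * Real.pi * Complex.I * ((2:ℂ) ^ m - 2 ^ n) with hc
    have e : ∀ x : ℝ, (starRingEnd ℂ (u n x)) * u m x = Complex.exp (c * x) := by
      intro x
      unfold u
      rw [← Complex.exp_conj, ← Complex.exp_add]
      congr 1
      simp [hc, show (starRingEnd ℂ) (2:ℂ) = 2 from Complex.conj_ofNat 2]
      ring
    have hc0 : c ≠ 0 := by
      have : (2:ℂ) ^ m ≠ 2 ^ n := by
        intro h2
        have : (2:ℕ) ^ m = 2 ^ n := by exact_mod_cast h2
        exact h (Nat.pow_right_injective le_rfl this)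
      simp [hc, sub_eq_zero, this, Real.pi_ne_zero]
    simp only [e]
    rw [integral_exp_mul_complex hc0]
    have : Complex.exp (c * (1:ℝ)) = 1 := by
      rw [Complex.exp_eq_one_iff]
      refine ⟨2 ^ m - 2 ^ n, ?_⟩
      rw [hc]; push_cast; ring
    rw [this]; simp

end RR

namespace RR

section JQ
variable (p : ℝ) [hF : Fact (1 ≤ ENNReal.ofReal p)]

/-- `L^p([0,1])`. -/
abbrev LpI : Type := Lp ℂ (ENNReal.ofReal p) (volume : Measure I)

lemma uI_memLp (n : ℕ) : MemLp (fun x : I => u n (x : ℝ)) (ENNReal.ofReal p) (volume : Measure I) := by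
  apply MemLp.of_bound (Continuous.aestronglyMeasurable (by have := u_cont; fun_prop)) 1
  exact Filter.Eventually.of_forall fun x => by simp [u_norm]

noncomputable def U (n : ℕ) : LpI p := (uI_memLp p n).toLp _

lemma sum_U (N : ℕ) (c : ℕ → ℂ) : ∑ n ∈ Finset.range N, c n • U p n =
    (FS_memLp N c (ENNReal.ofReal p)).toLp _ := by
  induction N with
  | zero =>
    rw [Finset.sum_range_zero]
    symm
    rw [Lp.eq_zero_iff_ae_eq_zero]
    filter_upwards [(FS_memLp 0 c (ENNReal.ofReal p)).coeFn_toLp] with x hx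
    rw [hx]; simp [FS]
  | succ N ih =>
    rw [Finset.sum_range_succ, ih, U, ← MemLp.toLp_const_smul, ← MemLp.toLp_add]
    congr 1
    funext x
    simp [FS, Finset.sum_range_succ, mul_comm]

lemma sum_U_range (N : ℕ) (c : ℕ → ℂ) : ‖∑ n ∈ Finset.range N, c n • U p n‖ ≤
    kc (ENNReal.ofReal p) * Real.sqrt (∑ n ∈ Finset.range N, ‖c n‖ ^ 2) := by
  rw [sum_U, Lp.norm_toLp]
  exact ENNReal.toReal_le_of_le_ofReal (mul_nonneg (kc_nonneg _) (Real.sqrt_nonneg _))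
    (khinI _ ENNReal.ofReal_ne_top N c)

lemma sum_U_finset (s : Finset ℕ) (c : ℕ → ℂ) : ‖∑ n ∈ s, c n • U p n‖ ≤
    kc (ENNReal.ofReal p) * Real.sqrt (∑ n ∈ s, ‖c n‖ ^ 2) := by
  obtain ⟨N, hN⟩ := s.exists_nat_subset_range
  have h := sum_U_range p N (fun n => if n ∈ s then c n else 0)
  have e1 : ∑ n ∈ Finset.range N, (if n ∈ s then c n else 0) • U p n = ∑ n ∈ s, c n • U p n := by
    rw [← Finset.sum_subset hN]
    · exact Finset.sum_congr rfl fun n hn => by simp [hn]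
    · intro n _ hn; simp [hn]
  have e2 : ∑ n ∈ Finset.range N, ‖(if n ∈ s then c n else 0)‖ ^ 2 = ∑ n ∈ s, ‖c n‖ ^ 2 := by
    rw [← Finset.sum_subset hN]
    · exact Finset.sum_congr rfl fun n hn => by simp [hn]
    · intro n _ hn; simp [hn]
  rwa [e1, e2] at h

lemma J_summable (a : L2N) : Summable fun n => a n • U p n := by
  rw [summable_iff_vanishing_norm]
  intro ε hε
  have hs : Summable fun n => ‖a n‖ ^ 2 := by
    have := (lp.hasSum_norm (p := 2) (by norm_num) a).summable
    simpa using this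
  set K := kc (ENNReal.ofReal p) + 1 with hK
  have hK0 : 0 < K := by have := kc_nonneg (ENNReal.ofReal p); positivity
  obtain ⟨s, hs⟩ := summable_iff_vanishing_norm.1 hs ((ε / K) ^ 2) (by positivity)
  refine ⟨s, fun t ht => ?_⟩
  have h1 := hs t ht
  rw [Real.norm_of_nonneg (Finset.sum_nonneg fun _ _ => by positivity)] at h1
  have h2 : Real.sqrt (∑ n ∈ t, ‖a n‖ ^ 2) < ε / K := by
    rw [Real.sqrt_lt' (by positivity)]; exact h1
  refine (sum_U_finset p t _).trans_lt ?_
  have h3 := Real.sqrt_nonneg (∑ n ∈ t, ‖a n‖ ^ 2)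
  calc _ ≤ K * Real.sqrt (∑ n ∈ t, ‖a n‖ ^ 2) := by gcongr; linarith
    _ < K * (ε / K) := by gcongr
    _ = ε := by field_simp

noncomputable def opJ : L2N →L[ℂ] LpI p :=
  LinearMap.mkContinuous
    { toFun := fun a => ∑' n, a n • U p n
      map_add' := by
        intro a b
        rw [← (J_summable p a).tsum_add (J_summable p b)]
        congr 1; funext n
        rw [lp.coeFn_add, Pi.add_apply, add_smul]
      map_smul' := by
        intro c a
        rw [RingHom.id_apply, ← (J_summable p a).tsum_const_smul]
        congr 1; funext n
        rw [lp.coeFn_smul, Pi.smul_apply, smul_assoc] } (kc (ENNReal.ofReal p))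
    (by
      intro a
      refine le_of_tendsto (J_summable p a).hasSum.norm (Filter.Eventually.of_forall fun s => ?_)
      refine (sum_U_finset p s _).trans ?_
      have := kc_nonneg (ENNReal.ofReal p)
      gcongr
      rw [Real.sqrt_le_left (norm_nonneg _)]
      exact l2_sum_le a s)

lemma opJ_hasSum (a : L2N) : HasSum (fun n => a n • U p n) (opJ p a) := (J_summable p a).hasSum

lemma LpI_integrable (f : LpI p) : Integrable f := (Lp.memLp f).integrable hF.out

lemma qc_add (f g : LpI p) (n : ℕ) : qc (f + g : LpI p) n = qc f n + qc g n := by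
  unfold qc
  rw [← integral_add (qc_integrable (LpI_integrable p f) n) (qc_integrable (LpI_integrable p g) n)]
  apply integral_congr_ae
  filter_upwards [Lp.coeFn_add f g] with x hx
  rw [hx, Pi.add_apply, smul_add]

lemma qc_smul (c : ℂ) (f : LpI p) (n : ℕ) : qc (c • f : LpI p) n = c • qc f n := by
  unfold qc
  rw [← integral_smul]
  apply integral_congr_ae
  filter_upwards [Lp.coeFn_smul c f] with x hx
  rw [hx, Pi.smul_apply, smul_comm]

lemma qc_U (m n : ℕ) : qc (U p m) n = if m = n then 1 else 0 := by
  rw [← u_orth m n]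
  unfold qc
  apply integral_congr_ae
  filter_upwards [(uI_memLp p m).coeFn_toLp] with x hx
  rw [U, hx, smul_eq_mul]

variable (hp : 1 < p)

noncomputable def opQ : LpI p →L[ℂ] L2N :=
  LinearMap.mkContinuous
    { toFun := fun f => ⟨qc f, l2_mem _ _ (qc_bound hp f (Lp.memLp f))⟩
      map_add' := by
        intro f g
        apply lp.ext
        funext n
        exact qc_add p f g n
      map_smul' := by
        intro c f
        apply lp.ext
        funext n
        exact qc_smul p c f n } (kc (ENNReal.ofReal p.conjExponent))
    (by
      intro f
      refine l2_norm_le _ (mul_nonneg (kc_nonneg _) (norm_nonneg _)) ?_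
      rw [Lp.norm_def]
      exact qc_bound hp f (Lp.memLp f))

lemma opQ_apply (f : LpI p) (n : ℕ) : opQ p hp f n = qc f n := rfl

lemma opQ_opJ (a : L2N) : opQ p hp (opJ p a) = a := by
  apply lp.ext
  funext n
  have h := ((opJ_hasSum p a).mapL (opQ p hp)).mapL (lp.evalCLM ℂ (fun _ : ℕ => ℂ) 2 n)
  have h2 : ∀ m, (lp.evalCLM ℂ (fun _ : ℕ => ℂ) 2 n) (opQ p hp (a m • U p m)) = if m = n then a n else 0 := by
    intro m
    change opQ p hp (a m • U p m) n = _
    rw [opQ_apply, qc_smul, qc_U]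
    split_ifs with hmn
    · subst hmn; simp
    · simp
  simp only [h2] at h
  exact h.unique (hasSum_ite_eq n (a n))

end JQ

end RR

namespace RR

section emb
variable (p : ℝ) [hF : Fact (1 ≤ ENNReal.ofReal p)]

/-- Assemble `m` scalar functions into one vector valued function. -/
noncomputable def emb {m : ℕ} (x : Fin m → LpI p) :
    Lp (EuclideanSpace ℂ (Fin m)) (ENNReal.ofReal p) (volume : Measure I) :=
  ∑ k, (ContinuousLinearMap.toSpanSingleton ℂ (EuclideanSpace.single k (1 : ℂ))).compLpL
    (ENNReal.ofReal p) (volume : Measure I) (x k)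

lemma emb_coe {m : ℕ} (x : Fin m → LpI p) :
    ∀ᵐ w ∂(volume : Measure I), emb p x w = WithLp.toLp 2 (fun k => x k w) := by
  have h1 : ∀ᵐ w ∂(volume : Measure I), ∀ k : Fin m,
      (ContinuousLinearMap.toSpanSingleton ℂ (EuclideanSpace.single k (1 : ℂ))).compLpL
        (ENNReal.ofReal p) (volume : Measure I) (x k) w = x k w • EuclideanSpace.single k (1 : ℂ) := by
    rw [eventually_countable_forall]
    intro k
    exact ContinuousLinearMap.coeFn_compLpL _ (x k)
  have h2 := Lp.coeFn_finsetSum Finset.univ (fun k => (ContinuousLinearMap.toSpanSingleton ℂ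
    (EuclideanSpace.single k (1 : ℂ))).compLpL (ENNReal.ofReal p) (volume : Measure I) (x k))
  filter_upwards [h1, h2] with w h1 h2
  unfold emb
  rw [h2, Finset.sum_apply]
  simp only [h1]
  ext k
  simp [Finset.sum_apply, Pi.single_apply]

lemma emb_eLpNorm {m : ℕ} (x : Fin m → LpI p) :
    eLpNorm (fun w => (∑ k, ‖x k w‖ ^ 2) ^ (1 / 2 : ℝ)) (ENNReal.ofReal p) (volume : Measure I) =
      ENNReal.ofReal ‖emb p x‖ := by
  rw [Lp.norm_def, ENNReal.ofReal_toReal (Lp.memLp _).eLpNorm_ne_top]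
  apply eLpNorm_congr_norm_ae
  filter_upwards [emb_coe p x] with w hw
  rw [hw, EuclideanSpace.norm_eq, Real.sqrt_eq_rpow, Real.norm_of_nonneg (by positivity)]

lemma emb_add {m : ℕ} (x y : Fin m → LpI p) : emb p (fun k => x k + y k) = emb p x + emb p y := by
  simp only [emb, map_add, Finset.sum_add_distrib]

lemma emb_smul_le {m : ℕ} (x : Fin m → LpI p) (c : Fin m → ℂ) (hc : ∀ k, ‖c k‖ ≤ 1) :
    ‖emb p (fun k => c k • x k)‖ ≤ ‖emb p x‖ := by
  apply Lp.norm_le_norm_of_ae_le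
  have h1 : ∀ᵐ w ∂(volume : Measure I), ∀ k : Fin m, (c k • x k : LpI p) w = c k • x k w := by
    rw [eventually_countable_forall]
    intro k
    exact Lp.coeFn_smul _ _
  filter_upwards [h1, emb_coe p x, emb_coe p (fun k => c k • x k)] with w h1 h2 h3
  rw [h2, h3, EuclideanSpace.norm_eq, EuclideanSpace.norm_eq]
  apply Real.sqrt_le_sqrt
  apply Finset.sum_le_sum
  intro k _
  simp only [h1, norm_smul]
  gcongr
  exact mul_le_of_le_one_left (norm_nonneg _) (hc k)

lemma emb_FS {m : ℕ} (N : ℕ) (y : Fin m → ℕ → ℂ) :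
    emb p (fun k => ∑ n ∈ Finset.range N, y k n • U p n) =
      (FS_memLp N (fun n => (WithLp.toLp 2 (fun k => y k n) : EuclideanSpace ℂ (Fin m)))
        (ENNReal.ofReal p)).toLp _ := by
  apply Lp.ext
  have h1 : ∀ᵐ w ∂(volume : Measure I), ∀ k : Fin m,
      (∑ n ∈ Finset.range N, y k n • U p n : LpI p) w = FS N (y k) w := by
    rw [eventually_countable_forall]
    intro k
    rw [sum_U]
    exact MemLp.coeFn_toLp _
  filter_upwards [h1, emb_coe p (fun k => ∑ n ∈ Finset.range N, y k n • U p n),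
    (FS_memLp N (fun n => (WithLp.toLp 2 (fun k => y k n) : EuclideanSpace ℂ (Fin m)))
        (ENNReal.ofReal p)).coeFn_toLp] with w h1 h2 h3
  rw [h2, h3]
  simp only [h1]
  ext k
  simp [FS]

lemma emb_J {m : ℕ} (y : Fin m → L2N) :
    ‖emb p (fun k => opJ p (y k))‖ ≤ kc (ENNReal.ofReal p) * Real.sqrt (∑ k, ‖y k‖ ^ 2) := by
  have ht : Filter.Tendsto (fun N => emb p (fun k => ∑ n ∈ Finset.range N, y k n • U p n))
      Filter.atTop (nhds (emb p (fun k => opJ p (y k)))) := by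
    unfold emb
    apply tendsto_finsetSum
    intro k _
    exact ((ContinuousLinearMap.continuous _).tendsto _).comp (opJ_hasSum p (y k)).tendsto_sum_nat
  refine le_of_tendsto ht.norm (Filter.Eventually.of_forall fun N => ?_)
  rw [emb_FS, Lp.norm_toLp]
  have h0 := kc_nonneg (ENNReal.ofReal p)
  refine (ENNReal.toReal_le_of_le_ofReal (mul_nonneg h0 (Real.sqrt_nonneg _))
    (khinI _ ENNReal.ofReal_ne_top N _)).trans ?_
  gcongr
  simp only [EuclideanSpace.norm_sq_eq]
  rw [Finset.sum_comm]
  apply Finset.sum_le_sum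
  intro k _
  exact l2_sum_le (y k) _

lemma emb_Q (hp : 1 < p) {m : ℕ} (x : Fin m → LpI p) :
    ∑ k, ‖opQ p hp (x k)‖ ^ 2 ≤ (kc (ENNReal.ofReal p.conjExponent) * ‖emb p x‖) ^ 2 := by
  have ht : Filter.Tendsto (fun N => ∑ k, ∑ n ∈ Finset.range N, ‖opQ p hp (x k) n‖ ^ 2)
      Filter.atTop (nhds (∑ k, ‖opQ p hp (x k)‖ ^ 2)) := by
    apply tendsto_finsetSum
    intro k _
    have := (lp.hasSum_norm (p := 2) (by norm_num) (opQ p hp (x k))).tendsto_sum_nat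
    simpa using this
  refine le_of_tendsto ht (Filter.Eventually.of_forall fun N => ?_)
  rw [Lp.norm_def]
  refine le_trans (le_of_eq ?_) (qc_bound hp (emb p x) (Lp.memLp _) N)
  rw [Finset.sum_comm]
  apply Finset.sum_congr rfl
  intro n _
  rw [EuclideanSpace.norm_sq_eq]
  apply Finset.sum_congr rfl
  intro k _
  congr 2
  rw [opQ_apply]
  have hi : Integrable (emb p x : I → EuclideanSpace ℂ (Fin m)) := (Lp.memLp _).integrable hF.out
  have := (EuclideanSpace.proj (𝕜 := ℂ) k).integral_comp_comm (qc_integrable hi n)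
  change _ = EuclideanSpace.proj (𝕜 := ℂ) k (qc (emb p x) n)
  unfold qc
  rw [← this]
  apply integral_congr_ae
  filter_upwards [emb_coe p x] with w hw
  rw [hw]
  simp

/-- R-boundedness of perturbations of factorizable families. -/
lemma rbdd (hp : 1 < p) (F : Set (LpI p →L[ℂ] LpI p))
    (hFs : ∀ S ∈ F, ∃ (B : L2N →L[ℂ] L2N) (c : ℂ), ‖B‖ ≤ 8 ∧ ‖c‖ ≤ 1 ∧
      ∀ x, S x = opJ p (B (opQ p hp x)) + c • x) : RBoundedSet p F := by
  set K := kc (ENNReal.ofReal p) * (8 * kc (ENNReal.ofReal p.conjExponent)) with hK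
  have h0 := kc_nonneg (ENNReal.ofReal p)
  have h0' := kc_nonneg (ENNReal.ofReal p.conjExponent)
  have hK0 : 0 ≤ K := by positivity
  refine ⟨K + 1, by positivity, ?_⟩
  intro m S hS x
  choose B c hB hc hS using fun k => hFs (S k) (hS k)
  have e1 := emb_eLpNorm p (fun k => S k (x k))
  have e2 := emb_eLpNorm p x
  rw [e1, e2, ← ENNReal.ofReal_mul (by positivity)]
  apply ENNReal.ofReal_le_ofReal
  simp only [hS]
  rw [emb_add]
  refine (norm_add_le _ _).trans ?_
  rw [add_mul, one_mul]
  refine add_le_add ?_ (emb_smul_le p x c hc)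
  refine (emb_J p _).trans ?_
  rw [hK, mul_assoc]
  gcongr
  rw [Real.sqrt_le_left (by positivity)]
  calc ∑ k, ‖B k (opQ p hp (x k))‖ ^ 2 ≤ ∑ k, (8 * ‖opQ p hp (x k)‖) ^ 2 := by
        apply Finset.sum_le_sum
        intro k _
        gcongr
        refine ((B k).le_opNorm _).trans ?_
        gcongr
        exact hB k
    _ = 8 ^ 2 * ∑ k, ‖opQ p hp (x k)‖ ^ 2 := by
        rw [Finset.mul_sum]
        exact Finset.sum_congr rfl fun _ _ => by ring
    _ ≤ 8 ^ 2 * (kc (ENNReal.ofReal p.conjExponent) * ‖emb p x‖) ^ 2 := by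
        gcongr
        exact emb_Q p hp x
    _ = _ := by ring

noncomputable def opT (hp : 1 < p) : LpI p →L[ℂ] LpI p := (opJ p).comp (opA.comp (opQ p hp))

lemma opT_pow (hp : 1 < p) (n : ℕ) (x : LpI p) :
    (opT p hp ^ (n + 1)) x = opJ p ((opA ^ (n + 1)) (opQ p hp x)) := by
  induction n generalizing x with
  | zero => simp [opT]
  | succ n ih =>
    rw [pow_succ, ContinuousLinearMap.mul_apply, ih, pow_succ opA, ContinuousLinearMap.mul_apply]
    simp [opT, opQ_opJ]

lemma opT_rritt (hp : 1 < p) : RRitt p (opT p hp) := by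
  apply rbdd p hp
  rintro S (⟨n, rfl⟩ | ⟨n, hn, rfl⟩)
  · cases n with
    | zero => exact ⟨0, 1, by simp, by simp, fun x => by simp⟩
    | succ n =>
      exact ⟨opA ^ (n + 1), 0, (opA_pow _).trans (by norm_num), by simp, fun x => by
        rw [opT_pow, zero_smul, add_zero]⟩
  · obtain ⟨n, rfl⟩ := Nat.exists_eq_add_of_le' hn
    rw [Nat.add_sub_cancel]
    cases n with
    | zero =>
      refine ⟨opA, -1, ?_, by simp, fun x => ?_⟩
      · have := opA_pow 1
        rw [pow_one] at this
        linarith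
      · simp [opT, sub_eq_add_neg]
    | succ n =>
      refine ⟨((n + 1 + 1 : ℕ) : ℂ) • (opA ^ (n + 1 + 1) - opA ^ (n + 1)), 0, opA_diff (n + 1), by simp, fun x => ?_⟩
      simp only [ContinuousLinearMap.smul_apply, ContinuousLinearMap.sub_apply, opT_pow, map_smul, map_sub,
        zero_smul, add_zero]

lemma opT_aeval (hp : 1 < p) (φ : ℂ[X]) (a : L2N) :
    opQ p hp (aeval (opT p hp) φ (opJ p a)) = aeval opA φ a := by
  induction φ using Polynomial.induction_on' with
  | add f g hf hg => simp only [map_add, ContinuousLinearMap.add_apply, hf, hg]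
  | monomial n c =>
    simp only [aeval_monomial, Algebra.algebraMap_eq_smul_one, smul_mul_assoc, one_mul,
      ContinuousLinearMap.smul_apply, map_smul]
    congr 1
    cases n with
    | zero => simp [opQ_opJ]
    | succ n => rw [opT_pow, opQ_opJ, opQ_opJ]

lemma opT_aeval_norm (hp : 1 < p) (φ : ℂ[X]) :
    ‖aeval opA φ‖ ≤ ‖opQ p hp‖ * ‖opJ p‖ * ‖aeval (opT p hp) φ‖ := by
  refine ContinuousLinearMap.opNorm_le_bound _ (by positivity) fun a => ?_
  rw [← opT_aeval p hp]
  calc _ ≤ ‖opQ p hp‖ * ‖aeval (opT p hp) φ (opJ p a)‖ := ContinuousLinearMap.le_opNorm _ _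
    _ ≤ ‖opQ p hp‖ * (‖aeval (opT p hp) φ‖ * ‖opJ p a‖) := by
        gcongr; exact ContinuousLinearMap.le_opNorm _ _
    _ ≤ ‖opQ p hp‖ * (‖aeval (opT p hp) φ‖ * (‖opJ p‖ * ‖a‖)) := by
        gcongr; exact ContinuousLinearMap.le_opNorm _ _
    _ = _ := by ring

lemma final (hp : 1 < p) : RRitt p (opT p hp) ∧ ∀ C : ℝ, 1 ≤ C → ∃ φ : ℂ[X],
    C * ‖aeval (shiftOp (ENNReal.ofReal p)) φ‖ < ‖aeval (opT p hp) φ‖ := by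
  refine ⟨opT_rritt p hp, fun C hC => ?_⟩
  set D := ‖opQ p hp‖ * ‖opJ p‖ with hD
  have hD0 : 0 ≤ D := by positivity
  obtain ⟨φ, h1, h2⟩ := opA_unbdd (p := p) hp (D * (C * Kc p (Real.exp 2)) + 1)
  refine ⟨φ, ?_⟩
  have h3 := opT_aeval_norm p hp φ
  have h4 : C * ‖aeval (shiftOp (ENNReal.ofReal p)) φ‖ ≤ C * Kc p (Real.exp 2) := by gcongr
  refine h4.trans_lt ?_
  by_contra hc
  push Not at hc
  have := mul_le_mul_of_nonneg_left hc hD0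
  rw [← hD] at h3
  linarith

end emb

end RR

/-- for `1 < p < ∞`, there exists an R-Ritt operator `T` on `L^p([0,1])` which
is not `p`-polynomially bounded: for every `C ≥ 1` there is a polynomial `φ` with
`‖φ(T)‖ > C ‖φ(S)‖`, where `S` is the shift on `ℓ^p(ℤ)`. -/
theorem stmt_18 (p : ℝ) (hp : 1 < p) :
    letI : Fact (1 ≤ ENNReal.ofReal p) :=
      ⟨by rw [← ENNReal.ofReal_one]; exact ENNReal.ofReal_le_ofReal hp.le⟩
    ∃ T : Lp ℂ (ENNReal.ofReal p) (volume : Measure unitInterval) →L[ℂ]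
        Lp ℂ (ENNReal.ofReal p) (volume : Measure unitInterval),
      RRitt p T ∧
      ∀ C : ℝ, 1 ≤ C → ∃ φ : Polynomial ℂ,
        C * ‖aeval (shiftOp (ENNReal.ofReal p)) φ‖ < ‖aeval T φ‖ := by
  letI : Fact (1 ≤ ENNReal.ofReal p) :=
    ⟨by rw [← ENNReal.ofReal_one]; exact ENNReal.ofReal_le_ofReal hp.le⟩
  exact ⟨RR.opT p hp, RR.final p hp⟩
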